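/- Let μ be a g-invariant ergodic probability measure on Θ×𝕋 projecting to m in the first coordinate. If λ_m(A) = 0, then λ_μ(F_β,0) = log β. If λ_m(A) > 0, then λ_μ(F_β,0) ∈ {log β + λ_m(A), log β − λ_m(A)}, and each of these two values is attained by exactly one such ergodic measure μ. -/

import Mathlib

open Filter MeasureTheory Metric Set
open scoped Topology

noncomputable section

/-- ℝ² with the Euclidean norm. -/
abbrev R2 : Type := EuclideanSpace ℝ (Fin 2)

/-- Action of a 2×2 real matrix on Euclidean ℝ². -/
def mulVecE (M : Matrix (Fin 2) (Fin 2) ℝ) (v : R2) : R2 :=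
  (WithLp.equiv 2 (Fin 2 → ℝ)).symm (M.mulVec ((WithLp.equiv 2 (Fin 2 → ℝ)) v))

/-- Operator norm of a 2×2 real matrix induced by the Euclidean norm on ℝ². -/
def opNorm (M : Matrix (Fin 2) (Fin 2) ℝ) : ℝ :=
  ‖(Matrix.toEuclideanCLM (𝕜 := ℝ) M : R2 →L[ℝ] R2)‖

/-- The cocycle `A_n(θ) = A(γ^{n-1}θ) ⋯ A(θ)`. -/
def coc {Θ : Type*} (γ : Θ → Θ) (A : Θ → Matrix (Fin 2) (Fin 2) ℝ) :
    ℕ → Θ → Matrix (Fin 2) (Fin 2) ℝ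
  | 0, _ => 1
  | n + 1, θ => coc γ A n (γ θ) * A θ

/-- Maximal Lyapunov exponent `λ_max(A) = sup_θ limsup (1/n) log‖A_n(θ)‖`. -/
def lyapMax {Θ : Type*} (γ : Θ → Θ) (A : Θ → Matrix (Fin 2) (Fin 2) ℝ) : ℝ :=
  ⨆ θ : Θ, Filter.limsup (fun n : ℕ => Real.log (opNorm (coc γ A n θ)) / n) Filter.atTop

/-- The hypotheses on `h`: C² on [0,∞), strictly increasing, strictly concave, bounded,
nonnegative, `h 0 = 0`, `h' 0 = 1`. -/
def GoodH (h : ℝ → ℝ) : Prop :=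
  ContDiffOn ℝ 2 h (Set.Ici 0) ∧ StrictMonoOn h (Set.Ici 0) ∧
    StrictConcaveOn ℝ (Set.Ici 0) h ∧ BddAbove (h '' Set.Ici 0) ∧
    (∀ x ∈ Set.Ici (0 : ℝ), 0 ≤ h x) ∧ h 0 = 0 ∧ derivWithin h (Set.Ici 0) 0 = 1

/-- The scaling condition `sup_{x ≥ 0} h(x) ≤ (sup_θ ‖A(θ)‖)⁻¹`. -/
def Scaled {Θ : Type*} (A : Θ → Matrix (Fin 2) (Fin 2) ℝ) (h : ℝ → ℝ) : Prop :=
  ∀ x ∈ Set.Ici (0 : ℝ), h x ≤ (⨆ θ : Θ, opNorm (A θ))⁻¹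

open scoped Classical in
/-- The fibre maps `f_{β,θ}(v) = h(β‖v‖)·A(θ)·v/‖v‖`, `f_{β,θ}(0) = 0`. -/
def fibMap {Θ : Type*} (A : Θ → Matrix (Fin 2) (Fin 2) ℝ) (h : ℝ → ℝ) (β : ℝ)
    (θ : Θ) (v : R2) : R2 :=
  if v = 0 then 0 else (h (β * ‖v‖) / ‖v‖) • mulVecE (A θ) v

/-- The skew product `f_β(θ,v) = (γθ, f_{β,θ}(v))`. -/
def skewProd {Θ : Type*} (γ : Θ → Θ) (A : Θ → Matrix (Fin 2) (Fin 2) ℝ) (h : ℝ → ℝ)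
    (β : ℝ) : Θ × R2 → Θ × R2 :=
  fun p => (γ p.1, fibMap A h β p.1 p.2)

/-- The global attractor `𝒜_β = ⋂_{n∈ℕ} f_β^n(Θ × B̄₁(0))`. -/
def globalAttractor {Θ : Type*} (γ : Θ → Θ) (A : Θ → Matrix (Fin 2) (Fin 2) ℝ)
    (h : ℝ → ℝ) (β : ℝ) : Set (Θ × R2) :=
  ⋂ n : ℕ, (skewProd γ A h β)^[n] '' (Set.univ ×ˢ Metric.closedBall (0 : R2) 1)

/-- The fibre `𝒜_β(θ) = {x : (θ,x) ∈ 𝒜_β}` of the global attractor. -/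
def attractorFib {Θ : Type*} (γ : Θ → Θ) (A : Θ → Matrix (Fin 2) (Fin 2) ℝ)
    (h : ℝ → ℝ) (β : ℝ) (θ : Θ) : Set R2 :=
  {x : R2 | (θ, x) ∈ globalAttractor γ A h β}

/-- `v(α) = (cos 2πα, sin 2πα)ᵗ`. -/
def vFull (α : ℝ) : R2 :=
  (WithLp.equiv 2 (Fin 2 → ℝ)).symm ![Real.cos (2 * Real.pi * α), Real.sin (2 * Real.pi * α)]

/-- `(cos πα, sin πα)ᵗ`, representing the projective point `α ∈ 𝕋 ≅ ℝP¹`. -/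
def vHalf (α : ℝ) : R2 :=
  (WithLp.equiv 2 (Fin 2 → ℝ)).symm ![Real.cos (Real.pi * α), Real.sin (Real.pi * α)]

/-- The projective angle coordinate `p(w) = (1/π)·arg(w) mod 1 ∈ [0,1)` of a nonzero
vector `w ∈ ℝ²`; for `w ≠ 0` this equals `(1/π)·arctan(w₂/w₁) mod 1`. -/
def projAngle (w : R2) : ℝ :=
  Int.fract (Complex.arg (Complex.ofReal (w 0) + Complex.ofReal (w 1) * Complex.I) / Real.pi)

/-- The projective action `g(θ,α) = (γθ, g_θ(α))` of the cocycle on `Θ × 𝕋`,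
where `𝕋` is modelled by the fundamental domain `[0,1) ⊆ ℝ`. -/
def gMap {Θ : Type*} (γ : Θ → Θ) (A : Θ → Matrix (Fin 2) (Fin 2) ℝ) :
    Θ × ℝ → Θ × ℝ :=
  fun p => (γ p.1, projAngle (mulVecE (A p.1) (vHalf p.2)))

/-- `Ω(θ,α) = ‖A(θ)(cos πα, sin πα)ᵗ‖`. -/
def Omega {Θ : Type*} (A : Θ → Matrix (Fin 2) (Fin 2) ℝ) (p : Θ × ℝ) : ℝ :=
  ‖mulVecE (A p.1) (vHalf p.2)‖

/-- The fibre maps `F_{β,θ,α}(r) = h(βr)·Ω(θ,α)` of the double skew product. -/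
def dsFib {Θ : Type*} (A : Θ → Matrix (Fin 2) (Fin 2) ℝ) (h : ℝ → ℝ) (β : ℝ)
    (p : Θ × ℝ) (r : ℝ) : ℝ :=
  h (β * r) * Omega A p

/-- The double skew product `F_β(θ,α,r) = (g(θ,α), h(βr)·Ω(θ,α))` on `Θ × 𝕋 × [0,∞)`. -/
def dsMap {Θ : Type*} (γ : Θ → Θ) (A : Θ → Matrix (Fin 2) (Fin 2) ℝ) (h : ℝ → ℝ)
    (β : ℝ) : Θ × ℝ × ℝ → Θ × ℝ × ℝ :=
  fun p => ((gMap γ A (p.1, p.2.1)).1, (gMap γ A (p.1, p.2.1)).2, dsFib A h β (p.1, p.2.1) p.2.2)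

/-- `Ω_n(θ,α) = ∏_{i=0}^{n-1} Ω(g^i(θ,α))`. -/
def OmegaProd {Θ : Type*} (γ : Θ → Θ) (A : Θ → Matrix (Fin 2) (Fin 2) ℝ) (n : ℕ)
    (p : Θ × ℝ) : ℝ :=
  ∏ i ∈ Finset.range n, Omega A ((gMap γ A)^[i] p)

/-- `Γ(a,b) = inf_{a ≤ x ≤ 1} inf_{0 < q ≤ b} h(qx)/(q·h(x))`. -/
def GammaH (h : ℝ → ℝ) (a b : ℝ) : ℝ :=
  sInf {y : ℝ | ∃ x ∈ Set.Icc a 1, ∃ q ∈ Set.Ioc (0 : ℝ) b, y = h (q * x) / (q * h x)}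

/-- The inverse `g⁻¹(θ,α) = (γ⁻¹θ, projective angle of A(γ⁻¹θ)⁻¹·v(α))` of the
projective action. -/
def gInv {Θ : Type*} (γinv : Θ → Θ) (A : Θ → Matrix (Fin 2) (Fin 2) ℝ) :
    Θ × ℝ → Θ × ℝ :=
  fun p => (γinv p.1, projAngle (mulVecE (A (γinv p.1))⁻¹ (vHalf p.2)))

/-- `F^n_{β,g^{-n}(θ,α)}(1)`, the pullback iterate defining the upper bounding graph. -/
def pullback1 {Θ : Type*} (γ : Θ → Θ) (γinv : Θ → Θ) (A : Θ → Matrix (Fin 2) (Fin 2) ℝ)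
    (h : ℝ → ℝ) (β : ℝ) (n : ℕ) (p : Θ × ℝ) : ℝ :=
  ((dsMap γ A h β)^[n] (((gInv γinv A)^[n] p).1, ((gInv γinv A)^[n] p).2, 1)).2.2

/-! ### Planar linear algebra -/

lemma mulVecE_eq_toEuclideanCLM (M : Matrix (Fin 2) (Fin 2) ℝ) (v : R2) :
    mulVecE M v = (Matrix.toEuclideanCLM (𝕜 := ℝ) M : R2 →L[ℝ] R2) v := rfl

lemma mulVecE_apply (M : Matrix (Fin 2) (Fin 2) ℝ) (v : R2) (i : Fin 2) :
    mulVecE M v i = M i 0 * v 0 + M i 1 * v 1 := by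
  simp only [mulVecE, WithLp.equiv_symm_apply, WithLp.equiv_apply, Matrix.mulVec, dotProduct,
    Fin.sum_univ_two]

lemma R2_ext {v w : R2} (h0 : v 0 = w 0) (h1 : v 1 = w 1) : v = w := by
  ext i; fin_cases i <;> assumption

lemma mulVecE_smul (M : Matrix (Fin 2) (Fin 2) ℝ) (c : ℝ) (v : R2) :
    mulVecE M (c • v) = c • mulVecE M v := by
  simp [mulVecE_eq_toEuclideanCLM]

lemma mulVecE_mul (M N : Matrix (Fin 2) (Fin 2) ℝ) (v : R2) :
    mulVecE (M * N) v = mulVecE M (mulVecE N v) := by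
  simp [mulVecE_eq_toEuclideanCLM]

lemma mulVecE_one (v : R2) : mulVecE 1 v = v := by
  simp [mulVecE_eq_toEuclideanCLM]

lemma norm_mulVecE_le (M : Matrix (Fin 2) (Fin 2) ℝ) (v : R2) :
    ‖mulVecE M v‖ ≤ opNorm M * ‖v‖ :=
  (Matrix.toEuclideanCLM (𝕜 := ℝ) M : R2 →L[ℝ] R2).le_opNorm v

/-- The planar cross product. -/
def cross (v w : R2) : ℝ := v 0 * w 1 - v 1 * w 0

lemma cross_mulVecE {M : Matrix (Fin 2) (Fin 2) ℝ} (hM : M.det = 1) (v w : R2) :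
    cross (mulVecE M v) (mulVecE M w) = cross v w := by
  rw [Matrix.det_fin_two] at hM
  simp only [cross, mulVecE_apply]
  linear_combination (v 0 * w 1 - v 1 * w 0) * hM

lemma norm_sq_R2 (v : R2) : ‖v‖ ^ 2 = v 0 ^ 2 + v 1 ^ 2 := by
  simp [EuclideanSpace.norm_sq_eq, Fin.sum_univ_two]

lemma abs_cross_le (v w : R2) : |cross v w| ≤ ‖v‖ * ‖w‖ := by
  apply abs_le_of_sq_le_sq _ (by positivity)
  rw [mul_pow, norm_sq_R2, norm_sq_R2, cross]
  nlinarith [sq_nonneg (v 0 * w 0 + v 1 * w 1)]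

/-- The rotation by a right angle. -/
def perp (v : R2) : R2 := (WithLp.equiv 2 (Fin 2 → ℝ)).symm ![-v 1, v 0]

@[simp] lemma perp_zero (v : R2) : perp v 0 = -v 1 := rfl

@[simp] lemma perp_one (v : R2) : perp v 1 = v 0 := rfl

lemma norm_perp (v : R2) : ‖perp v‖ = ‖v‖ := by
  rw [← sq_eq_sq₀ (norm_nonneg _) (norm_nonneg _), norm_sq_R2, norm_sq_R2]
  simp only [perp_zero, perp_one]
  ring

lemma cross_perp (v : R2) : cross v (perp v) = ‖v‖ ^ 2 := by
  rw [norm_sq_R2]; simp only [cross, perp_zero, perp_one]; ring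

lemma one_le_norm_mul_opNorm {M : Matrix (Fin 2) (Fin 2) ℝ} (hM : M.det = 1) {v : R2}
    (hv : ‖v‖ = 1) : 1 ≤ ‖mulVecE M v‖ * opNorm M := by
  have h1 := abs_cross_le (mulVecE M v) (mulVecE M (perp v))
  rw [cross_mulVecE hM, cross_perp, hv] at h1
  have h2 := norm_mulVecE_le M (perp v)
  rw [norm_perp, hv, mul_one] at h2
  calc (1 : ℝ) = |1 ^ 2| := by norm_num
    _ ≤ _ := h1.trans (by gcongr)

lemma opNorm_nonneg (M : Matrix (Fin 2) (Fin 2) ℝ) : 0 ≤ opNorm M := norm_nonneg _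

lemma norm_mulVecE_pos {M : Matrix (Fin 2) (Fin 2) ℝ} (hM : M.det = 1) {v : R2}
    (hv : ‖v‖ = 1) : 0 < ‖mulVecE M v‖ := by
  by_contra hcon
  have h0 : ‖mulVecE M v‖ = 0 := le_antisymm (not_lt.1 hcon) (norm_nonneg _)
  have := one_le_norm_mul_opNorm hM hv
  rw [h0] at this
  linarith

lemma one_le_opNorm {M : Matrix (Fin 2) (Fin 2) ℝ} (hM : M.det = 1) : 1 ≤ opNorm M := by
  have hv : ‖(EuclideanSpace.single 0 1 : R2)‖ = 1 := by simp
  have h1 := one_le_norm_mul_opNorm hM hv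
  have h2 := norm_mulVecE_le M (EuclideanSpace.single 0 1 : R2)
  rw [hv, mul_one] at h2
  nlinarith [opNorm_nonneg M]

lemma abs_log_norm_mulVecE_le {M : Matrix (Fin 2) (Fin 2) ℝ} (hM : M.det = 1) {v : R2}
    (hv : ‖v‖ = 1) : |Real.log ‖mulVecE M v‖| ≤ Real.log (opNorm M) := by
  have hp := norm_mulVecE_pos hM hv
  have hM1 := one_le_opNorm hM
  have h1 := one_le_norm_mul_opNorm hM hv
  have h2 := norm_mulVecE_le M v
  rw [hv, mul_one] at h2
  rw [abs_le]
  constructor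
  · have := Real.log_nonneg h1
    rw [Real.log_mul hp.ne' (by positivity)] at this
    linarith
  · exact Real.log_le_log hp h2

lemma opNorm_mul_le (M N : Matrix (Fin 2) (Fin 2) ℝ) : opNorm (M * N) ≤ opNorm M * opNorm N := by
  simp only [opNorm, map_mul]
  exact norm_mul_le _ _

lemma continuous_opNorm : Continuous opNorm := by
  unfold opNorm
  have : Continuous fun M : Matrix (Fin 2) (Fin 2) ℝ =>
      (Matrix.toEuclideanCLM (𝕜 := ℝ) M : R2 →L[ℝ] R2) :=
    LinearMap.continuous_of_finiteDimensional
      (Matrix.toEuclideanCLM (n := Fin 2) (𝕜 := ℝ)).toAlgEquiv.toLinearMap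
  exact this.norm

/-! ### Projective coordinates -/

@[simp] lemma vHalf_zero (α : ℝ) : vHalf α 0 = Real.cos (Real.pi * α) := rfl

@[simp] lemma vHalf_one (α : ℝ) : vHalf α 1 = Real.sin (Real.pi * α) := rfl

lemma norm_vHalf (α : ℝ) : ‖vHalf α‖ = 1 := by
  rw [← sq_eq_sq₀ (norm_nonneg _) zero_le_one, norm_sq_R2]
  simp

lemma cross_vHalf (α α' : ℝ) : cross (vHalf α) (vHalf α') = Real.sin (Real.pi * (α' - α)) := by
  rw [mul_sub, Real.sin_sub]; simp only [cross, vHalf_zero, vHalf_one]; ring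

lemma cross_smul_smul (c d : ℝ) (v w : R2) : cross (c • v) (d • w) = c * d * cross v w := by
  simp only [cross, PiLp.smul_apply, smul_eq_mul]; ring

lemma exists_smul_vHalf_projAngle (w : R2) :
    ∃ r : ℝ, |r| = ‖w‖ ∧ w = r • vHalf (projAngle w) := by
  set z : ℂ := Complex.ofReal (w 0) + Complex.ofReal (w 1) * Complex.I with hz
  have hzn : ‖z‖ = ‖w‖ := by
    rw [← sq_eq_sq₀ (norm_nonneg _) (norm_nonneg _), norm_sq_R2, Complex.sq_norm,
      Complex.normSq_apply]
    simp [hz]; ring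
  have harg : z.arg = Real.pi * projAngle w + ⌊z.arg / Real.pi⌋ * Real.pi := by
    have h1 : projAngle w + ⌊z.arg / Real.pi⌋ = z.arg / Real.pi := Int.fract_add_floor _
    field_simp at h1
    linarith
  have h0 : w 0 = ‖z‖ * Real.cos z.arg := by rw [Complex.norm_mul_cos_arg]; simp [hz]
  have h1 : w 1 = ‖z‖ * Real.sin z.arg := by rw [Complex.norm_mul_sin_arg]; simp [hz]
  refine ⟨‖w‖ * (-1) ^ ⌊z.arg / Real.pi⌋, ?_, ?_⟩
  · rw [abs_mul, abs_zpow]; simp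
  · apply R2_ext
    · rw [h0, hzn, harg, Real.cos_add_int_mul_pi, ← harg]
      simp [mul_assoc]
    · rw [h1, hzn, harg, Real.sin_add_int_mul_pi, ← harg]
      simp [mul_assoc]

lemma projAngle_mem (w : R2) : projAngle w ∈ Ico (0 : ℝ) 1 :=
  ⟨Int.fract_nonneg _, Int.fract_lt_one _⟩

lemma eq_of_sin_eq_zero {α α' : ℝ} (hα : α ∈ Ico (0 : ℝ) 1) (hα' : α' ∈ Ico (0 : ℝ) 1)
    (hs : Real.sin (Real.pi * (α' - α)) = 0) : α = α' := by
  obtain ⟨n, hn⟩ := Real.sin_eq_zero_iff.1 hs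
  have hn' : (n : ℝ) = α' - α := by
    have := Real.pi_ne_zero
    field_simp at hn
    exact hn
  have h1 : (-1 : ℝ) < n := by rw [hn']; linarith [hα.1, hα.2, hα'.1, hα'.2]
  have h2 : (n : ℝ) < 1 := by rw [hn']; linarith [hα.1, hα.2, hα'.1, hα'.2]
  have h3 : n = 0 := by
    have h1' : -1 < n := by exact_mod_cast h1
    have h2' : n < 1 := by exact_mod_cast h2
    omega
  rw [h3] at hn'
  push_cast at hn'
  linarith

lemma projAngle_smul {c : ℝ} (hc : c ≠ 0) {w : R2} (hw : w ≠ 0) :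
    projAngle (c • w) = projAngle w := by
  obtain ⟨r, hr, hr'⟩ := exists_smul_vHalf_projAngle w
  obtain ⟨s, hs, hs'⟩ := exists_smul_vHalf_projAngle (c • w)
  have hr0 : r ≠ 0 := by
    rintro rfl; simp at hr; exact hw (norm_eq_zero.1 hr.symm)
  have hs0 : s ≠ 0 := by
    rintro rfl
    rw [abs_zero, eq_comm, norm_eq_zero, smul_eq_zero] at hs
    tauto
  apply eq_of_sin_eq_zero (projAngle_mem _) (projAngle_mem _)
  rw [← cross_vHalf]
  have h1 : cross (c • w) w = 0 := by simp only [cross, PiLp.smul_apply, smul_eq_mul]; ring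
  have h2 : cross (c • w) w = s * r * cross (vHalf (projAngle (c • w))) (vHalf (projAngle w)) := by
    rw [← cross_smul_smul, ← hr', ← hs']
  rw [h1] at h2
  have := mul_ne_zero hs0 hr0
  simpa [this] using h2.symm

lemma measurable_projAngle : Measurable projAngle := by
  unfold projAngle
  have h0 : Measurable fun w : R2 => w 0 := by fun_prop
  have h1 : Measurable fun w : R2 => w 1 := by fun_prop
  have : Measurable fun w : R2 => (w 0 : ℂ) + (w 1 : ℂ) * Complex.I :=
    (Complex.measurable_ofReal.comp h0).add ((Complex.measurable_ofReal.comp h1).mul_const _)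
  exact measurable_fract.comp ((Complex.measurable_arg.comp this).div_const _)

lemma continuous_vHalf : Continuous vHalf := by
  unfold vHalf
  refine (PiLp.continuous_toLp 2 _).comp (continuous_pi fun i => ?_)
  fin_cases i <;> simp <;> fun_prop

lemma continuous_mulVecE : Continuous fun q : Matrix (Fin 2) (Fin 2) ℝ × R2 => mulVecE q.1 q.2 := by
  unfold mulVecE
  refine (PiLp.continuous_toLp 2 _).comp ?_
  exact continuous_fst.matrix_mulVec ((PiLp.continuous_ofLp 2 _).comp continuous_snd)

lemma MeasureTheory.MeasurePreserving.integral_comp_of_measurable {X Y : Type*}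
    [MeasurableSpace X] [MeasurableSpace Y] {ρ : Measure X} {ρ' : Measure Y} {S : X → Y}
    (hS : MeasurePreserving S ρ ρ') {f : Y → ℝ} (hf : Measurable f) :
    ∫ x, f (S x) ∂ρ = ∫ y, f y ∂ρ' := by
  rw [← hS.map_eq, integral_map hS.aemeasurable hf.aestronglyMeasurable]

/-! ### The projective cocycle -/

instance : MeasurableSpace (Matrix (Fin 2) (Fin 2) ℝ) :=
  inferInstanceAs (MeasurableSpace (Fin 2 → Fin 2 → ℝ))

instance : BorelSpace (Matrix (Fin 2) (Fin 2) ℝ) :=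
  inferInstanceAs (BorelSpace (Fin 2 → Fin 2 → ℝ))

instance : SecondCountableTopology (Matrix (Fin 2) (Fin 2) ℝ) :=
  inferInstanceAs (SecondCountableTopology (Fin 2 → Fin 2 → ℝ))

/-- A bounded measurable `SL(2,ℝ)`-cocycle. -/
structure BoundedSL {Ω : Type*} [MeasurableSpace Ω] (A : Ω → Matrix (Fin 2) (Fin 2) ℝ) :
    Prop where
  measurable : Measurable A
  det : ∀ ω, (A ω).det = 1
  bdd : ∃ C : ℝ, ∀ ω, opNorm (A ω) ≤ C

section Cocycle

variable {Ω : Type*} {T : Ω → Ω} {A : Ω → Matrix (Fin 2) (Fin 2) ℝ}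

lemma det_coc (hdet : ∀ ω, (A ω).det = 1) (n : ℕ) (ω : Ω) : (coc T A n ω).det = 1 := by
  induction n generalizing ω with
  | zero => simp [coc]
  | succ n ih => simp [coc, Matrix.det_mul, ih, hdet]

lemma Omega_pos (hdet : ∀ ω, (A ω).det = 1) (p : Ω × ℝ) : 0 < Omega A p :=
  norm_mulVecE_pos (hdet _) (norm_vHalf _)

lemma exists_smul_vHalf_gMap (p : Ω × ℝ) :
    ∃ r : ℝ, |r| = Omega A p ∧ mulVecE (A p.1) (vHalf p.2) = r • vHalf (gMap T A p).2 :=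
  exists_smul_vHalf_projAngle _

/-- The logarithmic growth of the cocycle after `n` steps in a projective direction. -/
def logGrowth (T : Ω → Ω) (A : Ω → Matrix (Fin 2) (Fin 2) ℝ) (n : ℕ) (p : Ω × ℝ) : ℝ :=
  Real.log ‖mulVecE (coc T A n p.1) (vHalf p.2)‖

lemma logGrowth_zero (p : Ω × ℝ) : logGrowth T A 0 p = 0 := by
  simp [logGrowth, coc, mulVecE_one, norm_vHalf]

lemma logGrowth_succ (hdet : ∀ ω, (A ω).det = 1) (n : ℕ) (p : Ω × ℝ) :
    logGrowth T A (n + 1) p = Real.log (Omega A p) + logGrowth T A n (gMap T A p) := by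
  obtain ⟨r, hr, hr'⟩ := exists_smul_vHalf_gMap (T := T) (A := A) p
  have h1 := norm_mulVecE_pos (det_coc (T := T) hdet n (T p.1)) (norm_vHalf (gMap T A p).2)
  rw [logGrowth, coc, mulVecE_mul, hr', mulVecE_smul, norm_smul, Real.norm_eq_abs, hr,
    Real.log_mul (Omega_pos hdet p).ne' h1.ne']
  rfl

lemma abs_logGrowth_le (hdet : ∀ ω, (A ω).det = 1) (n : ℕ) (p : Ω × ℝ) :
    |logGrowth T A n p| ≤ Real.log (opNorm (coc T A n p.1)) :=
  abs_log_norm_mulVecE_le (det_coc hdet _ _) (norm_vHalf _)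

lemma sin_gMap (hdet : ∀ ω, (A ω).det = 1) (ω : Ω) (α α' : ℝ) :
    Omega A (ω, α) * Omega A (ω, α') *
      |Real.sin (Real.pi * ((gMap T A (ω, α')).2 - (gMap T A (ω, α)).2))| =
      |Real.sin (Real.pi * (α' - α))| := by
  obtain ⟨r, hr, hr'⟩ := exists_smul_vHalf_gMap (T := T) (A := A) (ω, α)
  obtain ⟨s, hs, hs'⟩ := exists_smul_vHalf_gMap (T := T) (A := A) (ω, α')
  rw [← hr, ← hs, ← cross_vHalf, ← cross_vHalf, ← abs_mul, ← abs_mul, ← cross_smul_smul,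
    ← hr', ← hs', cross_mulVecE (hdet _)]

namespace BoundedSL

variable [MeasurableSpace Ω] (hA : BoundedSL A)
include hA

lemma measurable_mulVecE_vHalf :
    Measurable fun p : Ω × ℝ => mulVecE (A p.1) (vHalf p.2) :=
  continuous_mulVecE.measurable.comp
    ((hA.measurable.comp measurable_fst).prodMk (continuous_vHalf.measurable.comp measurable_snd))

lemma measurable_Omega : Measurable (Omega A) :=
  hA.measurable_mulVecE_vHalf.norm

lemma measurable_gMap (hT : Measurable T) : Measurable (gMap T A) :=
  (hT.comp measurable_fst).prodMk (measurable_projAngle.comp hA.measurable_mulVecE_vHalf)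

lemma measurable_coc (hT : Measurable T) (n : ℕ) : Measurable (coc T A n) := by
  induction n with
  | zero => exact measurable_const
  | succ n ih =>
    have hmul : Continuous fun q : Matrix (Fin 2) (Fin 2) ℝ × Matrix (Fin 2) (Fin 2) ℝ =>
        q.1 * q.2 := continuous_fst.mul continuous_snd
    exact hmul.measurable.comp ((ih.comp hT).prodMk hA.measurable)

lemma measurable_opNorm_coc (hT : Measurable T) (n : ℕ) :
    Measurable fun ω => Real.log (opNorm (coc T A n ω)) :=
  Real.measurable_log.comp (continuous_opNorm.measurable.comp (hA.measurable_coc hT n))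

lemma exists_log_opNorm_coc_le (T : Ω → Ω) :
    ∃ C : ℝ, ∀ n ω, |Real.log (opNorm (coc T A n ω))| ≤ n * C := by
  obtain ⟨C, hC⟩ := hA.bdd
  refine ⟨Real.log C, fun n => ?_⟩
  induction n with
  | zero => intro ω; simp [coc, opNorm]
  | succ n ih =>
    intro ω
    have h1 := one_le_opNorm (det_coc (T := T) hA.det (n + 1) ω)
    have h2 := one_le_opNorm (det_coc (T := T) hA.det n (T ω))
    have h3 := one_le_opNorm (hA.det ω)
    rw [abs_of_nonneg (Real.log_nonneg h1)]
    have h4 : Real.log (opNorm (coc T A (n + 1) ω)) ≤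
        Real.log (opNorm (coc T A n (T ω))) + Real.log (opNorm (A ω)) := by
      rw [← Real.log_mul (by positivity) (by positivity)]
      exact Real.log_le_log (by positivity) (opNorm_mul_le _ _)
    have h5 := (le_abs_self _).trans (ih (T ω))
    have h6 := Real.log_le_log (by positivity) (hC ω)
    push_cast
    linarith

lemma integrable_log_opNorm_coc (hT : Measurable T) (n : ℕ) (m : Measure Ω) [IsFiniteMeasure m] :
    Integrable (fun ω => Real.log (opNorm (coc T A n ω))) m := by
  obtain ⟨C, hC⟩ := hA.exists_log_opNorm_coc_le T
  exact .of_bound (hA.measurable_opNorm_coc hT n).aestronglyMeasurable (n * C)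
    (.of_forall (hC n))

lemma exists_abs_log_Omega_le : ∃ C : ℝ, ∀ p, |Real.log (Omega A p)| ≤ C := by
  obtain ⟨C, hC⟩ := hA.bdd
  refine ⟨Real.log C, fun p => (abs_log_norm_mulVecE_le (hA.det _) (norm_vHalf _)).trans ?_⟩
  have := one_le_opNorm (hA.det p.1)
  exact Real.log_le_log (by positivity) (hC _)

lemma integrable_log_Omega (ν : Measure (Ω × ℝ)) [IsFiniteMeasure ν] :
    Integrable (fun p => Real.log (Omega A p)) ν := by
  obtain ⟨C, hC⟩ := hA.exists_abs_log_Omega_le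
  exact .of_bound (Real.measurable_log.comp hA.measurable_Omega).aestronglyMeasurable C
    (.of_forall hC)

lemma measurable_logGrowth (hT : Measurable T) (n : ℕ) : Measurable (logGrowth T A n) :=
  Real.measurable_log.comp (continuous_mulVecE.measurable.comp
    (((hA.measurable_coc hT n).comp measurable_fst).prodMk
      (continuous_vHalf.measurable.comp measurable_snd))).norm

lemma integrable_logGrowth (hT : Measurable T) (n : ℕ) (ν : Measure (Ω × ℝ)) [IsFiniteMeasure ν] :
    Integrable (logGrowth T A n) ν := by
  obtain ⟨C, hC⟩ := hA.exists_log_opNorm_coc_le T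
  exact .of_bound (hA.measurable_logGrowth hT n).aestronglyMeasurable (n * C)
    (.of_forall fun p => (abs_logGrowth_le hA.det n p).trans ((le_abs_self _).trans (hC n p.1)))

lemma integral_logGrowth (hT : Measurable T) {ν : Measure (Ω × ℝ)} [IsFiniteMeasure ν]
    (hν : MeasurePreserving (gMap T A) ν ν) (n : ℕ) :
    ∫ p, logGrowth T A n p ∂ν = n * ∫ p, Real.log (Omega A p) ∂ν := by
  induction n with
  | zero => simp [logGrowth_zero]
  | succ n ih =>
    have hi := hA.integrable_logGrowth hT n ν
    have hi' : Integrable (fun p => logGrowth T A n (gMap T A p)) ν :=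
      hν.integrable_comp_of_integrable hi
    have h2 : ∫ p, logGrowth T A n (gMap T A p) ∂ν = ∫ p, logGrowth T A n p ∂ν :=
      hν.integral_comp_of_measurable (hA.measurable_logGrowth hT n)
    simp only [logGrowth_succ hA.det]
    rw [integral_add (hA.integrable_log_Omega ν) hi', h2, ih]
    push_cast
    ring

/-- The exponent of a lift of `c • m` is bounded by `c` times the exponent of the cocycle. -/
lemma abs_integral_log_Omega_le (hT : Measurable T) {m : Measure Ω} [IsFiniteMeasure m]
    {lam : ℝ} (hlam : Tendsto (fun n : ℕ => (∫ ω, Real.log (opNorm (coc T A n ω)) ∂m) / n)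
      atTop (𝓝 lam)) {ν : Measure (Ω × ℝ)} [IsFiniteMeasure ν]
    (hν : MeasurePreserving (gMap T A) ν ν) {c : NNReal} (hc : ν.map Prod.fst = c • m) :
    |∫ p, Real.log (Omega A p) ∂ν| ≤ c * lam := by
  refine ge_of_tendsto (hlam.const_mul (c : ℝ)) ?_
  filter_upwards [eventually_gt_atTop 0] with n hn
  have hn' : (0 : ℝ) < n := by exact_mod_cast hn
  rw [← mul_div_assoc, le_div_iff₀ hn']
  calc |∫ p, Real.log (Omega A p) ∂ν| * n = |∫ p, logGrowth T A n p ∂ν| := by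
        rw [hA.integral_logGrowth hT hν, abs_mul, Nat.abs_cast, mul_comm]
    _ ≤ ∫ p, |logGrowth T A n p| ∂ν := abs_integral_le_integral_abs
    _ ≤ ∫ p, Real.log (opNorm (coc T A n p.1)) ∂ν := by
        refine integral_mono (hA.integrable_logGrowth hT n ν).abs ?_
          fun p => abs_logGrowth_le hA.det n p
        exact (hA.integrable_log_opNorm_coc hT n (ν.map Prod.fst)).comp_measurable measurable_fst
    _ = ∫ ω, Real.log (opNorm (coc T A n ω)) ∂(ν.map Prod.fst) := by
        rw [integral_map measurable_fst.aemeasurable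
          (hA.measurable_opNorm_coc hT n).aestronglyMeasurable]
    _ = c * ∫ ω, Real.log (opNorm (coc T A n ω)) ∂m := by
        rw [hc, integral_smul_nnreal_measure, NNReal.smul_def, smul_eq_mul]

end BoundedSL

end Cocycle

/-! ### Disintegration of skew product measures -/

section SkewProduct

open ProbabilityTheory

/-- A coboundary which is integrable has zero integral, without integrability of the transfer
function. -/
lemma integral_coboundary_eq_zero {X : Type*} [MeasurableSpace X] {ρ : Measure X}
    [IsFiniteMeasure ρ] {S : X → X} (hS : MeasurePreserving S ρ ρ) {u : X → ℝ} (hu : Measurable u)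
    (hμint : Integrable (fun x => u (S x) - u x) ρ) : ∫ x, (u (S x) - u x) ∂ρ = 0 := by
  let τ : ℕ → ℝ → ℝ := fun N y => max (-N) (min N y)
  have hτm : ∀ N, Measurable (τ N) := fun N =>
    measurable_const.max (measurable_const.min measurable_id)
  have hτb : ∀ N y, ‖τ N y‖ ≤ N := fun N y => by
    rw [Real.norm_eq_abs, abs_le]
    exact ⟨le_max_left _ _, max_le (by linarith [Nat.cast_nonneg (α := ℝ) N]) (min_le_left _ _)⟩
  have hτl : ∀ N x y, |τ N x - τ N y| ≤ |x - y| := fun N x y =>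
    (abs_max_sub_max_le_max _ _ _ _).trans <| by
      simpa using (abs_min_sub_min_le_max (N : ℝ) x N y)
  have hτt : ∀ y, Tendsto (fun N => τ N y) atTop (𝓝 y) := fun y => by
    refine tendsto_const_nhds.congr' ?_
    filter_upwards [eventually_ge_atTop ⌈|y|⌉₊] with N hN
    have h1 : |y| ≤ N := (Nat.le_ceil _).trans (by exact_mod_cast hN)
    obtain ⟨h2, h3⟩ := abs_le.1 h1
    simp only [τ]
    rw [min_eq_right h3, max_eq_right h2]
  have hlim : Tendsto (fun N => ∫ x, (τ N (u (S x)) - τ N (u x)) ∂ρ) atTop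
      (𝓝 (∫ x, (u (S x) - u x) ∂ρ)) := by
    refine tendsto_integral_of_dominated_convergence (fun x => |u (S x) - u x|)
      (fun N => ?_) hμint.abs (fun N => .of_forall fun x => hτl N _ _)
      (.of_forall fun x => (hτt _).sub (hτt _))
    exact (((hτm N).comp (hu.comp hS.measurable)).sub ((hτm N).comp hu)).aestronglyMeasurable
  have hzero : ∀ N, ∫ x, (τ N (u (S x)) - τ N (u x)) ∂ρ = 0 := fun N => by
    have hi : Integrable (fun x => τ N (u x)) ρ :=
      .of_bound ((hτm N).comp hu).aestronglyMeasurable N (.of_forall fun x => hτb N _)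
    have hi' : Integrable (fun x => τ N (u (S x))) ρ := hS.integrable_comp_of_integrable hi
    have h2 : ∫ x, τ N (u (S x)) ∂ρ = ∫ x, τ N (u x) ∂ρ :=
      hS.integral_comp_of_measurable ((hτm N).comp hu)
    rw [integral_sub hi' hi, h2, sub_self]
  simp only [hzero] at hlim
  exact (tendsto_nhds_unique hlim tendsto_const_nhds)

lemma MeasureTheory.MeasurePreserving.map_of_semiconj {X Y : Type*} [MeasurableSpace X]
    [MeasurableSpace Y] {ρ : Measure X} {S : X → X} (hS : MeasurePreserving S ρ ρ) {P : X → Y}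
    (hP : Measurable P) {g : Y → Y} (hg : Measurable g) (h : Function.Semiconj P S g) :
    MeasurePreserving g (ρ.map P) (ρ.map P) := by
  refine ⟨hg, ?_⟩
  rw [Measure.map_map hg hP, ← h.comp_eq, ← Measure.map_map hP hS.measurable, hS.map_eq]

variable {Ω F : Type*} [MeasurableSpace Ω] [MeasurableSpace F] {m : Measure Ω}

lemma condKernel_equivariant [StandardBorelSpace F] [Nonempty F] {T : Ω ≃ᵐ Ω}
    (hT : MeasurePreserving T m m) {S : Ω × F → Ω × F} (hS1 : ∀ p, (S p).1 = T p.1)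
    {μ : Measure (Ω × F)} [IsFiniteMeasure μ] (hμ : MeasurePreserving S μ μ) (hm : μ.fst = m) :
    ∀ᵐ ω ∂m, (μ.condKernel ω).map (fun x => (S (ω, x)).2) = μ.condKernel (T ω) := by
  have hS := hμ.measurable
  have hS2 : Measurable fun p => (S p).2 := measurable_snd.comp hS
  have hS2' : ∀ ω, Measurable fun x => (S (ω, x)).2 := fun ω => hS2.comp measurable_prodMk_left
  let η₀ : Kernel Ω F := (Kernel.id ×ₖ μ.condKernel).map fun p => (S p).2
  have hη₀ : ∀ ω, η₀ ω = (μ.condKernel ω).map (fun x => (S (ω, x)).2) := fun ω => by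
    rw [Kernel.map_apply _ hS2, Kernel.prod_apply, Kernel.id_apply, Measure.dirac_prod,
      Measure.map_map hS2 measurable_prodMk_left]
    rfl
  have : IsFiniteKernel η₀ := Kernel.IsFiniteKernel.map _ _
  let η : Kernel Ω F := η₀.comap T.symm T.symm.measurable
  have key : μ = μ.fst ⊗ₘ η := by
    refine Measure.ext_of_lintegral _ fun f hf => ?_
    rw [Measure.lintegral_compProd hf, hm]
    have hfη : Measurable fun ω => ∫⁻ x, f (ω, x) ∂η ω := hf.lintegral_kernel_prod_right'
    rw [← hT.lintegral_comp hfη, ← hμ.lintegral_comp hf]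
    conv_lhs => rw [← μ.disintegrate μ.condKernel]
    have hfS : Measurable fun p => f (S p) := hf.comp hS
    rw [Measure.lintegral_compProd hfS, hm]
    refine lintegral_congr fun ω => ?_
    simp only [η, Kernel.comap_apply, MeasurableEquiv.symm_apply_apply, hη₀]
    have hfω : Measurable fun y => f (T ω, y) := hf.comp measurable_prodMk_left
    rw [lintegral_map hfω (hS2' ω)]
    refine lintegral_congr fun x => ?_
    rw [← hS1 (ω, x)]
  have hae := eq_condKernel_of_measure_eq_compProd η key
  rw [hm] at hae
  filter_upwards [hT.quasiMeasurePreserving.ae hae] with ω hω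
  rw [← hω, ← hη₀]
  simp [η, Kernel.comap_apply]

lemma measurePreserving_compProd_of_equivariant [SFinite m] {T : Ω → Ω}
    (hT : MeasurePreserving T m m)
    {S : Ω × F → Ω × F} (hS : Measurable S) (hS1 : ∀ p, (S p).1 = T p.1) {κ : Kernel Ω F}
    [IsSFiniteKernel κ]
    (hκ : ∀ᵐ ω ∂m, (κ ω).map (fun x => (S (ω, x)).2) = κ (T ω)) :
    MeasurePreserving S (m ⊗ₘ κ) (m ⊗ₘ κ) := by
  refine ⟨hS, Measure.ext_of_lintegral _ fun f hf => ?_⟩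
  have hS2' : ∀ ω, Measurable fun x => (S (ω, x)).2 := fun ω =>
    (measurable_snd.comp hS).comp measurable_prodMk_left
  have hfS : Measurable fun p => f (S p) := hf.comp hS
  rw [lintegral_map hf hS, Measure.lintegral_compProd hfS, Measure.lintegral_compProd hf,
    ← hT.lintegral_comp hf.lintegral_kernel_prod_right']
  refine lintegral_congr_ae ?_
  filter_upwards [hκ] with ω hω
  have hfω : Measurable fun y => f (T ω, y) := hf.comp measurable_prodMk_left
  rw [← hω, lintegral_map hfω (hS2' ω)]
  refine lintegral_congr fun x => ?_
  rw [← hS1 (ω, x)]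

end SkewProduct

/-! ### Joinings of projective lifts -/

section Joining

open ProbabilityTheory

variable {Ω : Type*} [MeasurableSpace Ω] {m : Measure Ω} [IsProbabilityMeasure m] {T : Ω ≃ᵐ Ω}
  {A : Ω → Matrix (Fin 2) (Fin 2) ℝ}

/-- Two invariant lifts of the same measure are equal, or they have nonzero invariant parts,
lifting the same measure, whose exponents are opposite. -/
lemma BoundedSL.eq_or_exists_opposite (hA : BoundedSL A) (hT : MeasurePreserving T m m)
    {μ₁ μ₂ : Measure (Ω × ℝ)} [IsProbabilityMeasure μ₁] [IsProbabilityMeasure μ₂]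
    (h₁ : MeasurePreserving (gMap T A) μ₁ μ₁) (h₂ : MeasurePreserving (gMap T A) μ₂ μ₂)
    (hm₁ : μ₁.map Prod.fst = m) (hm₂ : μ₂.map Prod.fst = m) :
    μ₁ = μ₂ ∨ ∃ ν₁ ν₁' ν₂ ν₂' : Measure (Ω × ℝ), μ₁ = ν₁ + ν₁' ∧ μ₂ = ν₂ + ν₂' ∧
      MeasurePreserving (gMap T A) ν₁ ν₁ ∧ MeasurePreserving (gMap T A) ν₁' ν₁' ∧
      MeasurePreserving (gMap T A) ν₂ ν₂ ∧ MeasurePreserving (gMap T A) ν₂' ν₂' ∧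
      ν₁.map Prod.fst = ν₂.map Prod.fst ∧ ν₁ ≠ 0 ∧
      ∫ p, Real.log (Omega A p) ∂ν₁ + ∫ p, Real.log (Omega A p) ∂ν₂ = 0 := by
  have hg := hA.measurable_gMap T.measurable
  have hg2 : Measurable fun p => (gMap T A p).2 := measurable_snd.comp hg
  have hgω : ∀ ω, Measurable fun α => (gMap T A (ω, α)).2 := fun ω =>
    hg2.comp measurable_prodMk_left
  let κ₁ : Kernel Ω ℝ := μ₁.condKernel
  let κ₂ : Kernel Ω ℝ := μ₂.condKernel
  have hκ₁ := condKernel_equivariant hT (S := gMap T A) (fun _ => rfl) h₁ hm₁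
  have hκ₂ := condKernel_equivariant hT (S := gMap T A) (fun _ => rfl) h₂ hm₂
  let J : Measure (Ω × ℝ × ℝ) := m ⊗ₘ (κ₁ ×ₖ κ₂)
  let S : Ω × ℝ × ℝ → Ω × ℝ × ℝ := fun q =>
    (T q.1, (gMap T A (q.1, q.2.1)).2, (gMap T A (q.1, q.2.2)).2)
  let P₁ : Ω × ℝ × ℝ → Ω × ℝ := fun q => (q.1, q.2.1)
  let P₂ : Ω × ℝ × ℝ → Ω × ℝ := fun q => (q.1, q.2.2)
  have hP₁ : Measurable P₁ := by fun_prop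
  have hP₂ : Measurable P₂ := by fun_prop
  have hSm : Measurable S := (T.measurable.comp measurable_fst).prodMk
    ((hg2.comp hP₁).prodMk (hg2.comp hP₂))
  have hS : MeasurePreserving S J J := by
    refine measurePreserving_compProd_of_equivariant hT hSm (fun _ => rfl) ?_
    filter_upwards [hκ₁, hκ₂] with ω hω₁ hω₂
    rw [Kernel.prod_apply, Kernel.prod_apply]
    change ((κ₁ ω).prod (κ₂ ω)).map (Prod.map (fun α => (gMap T A (ω, α)).2)
      (fun α => (gMap T A (ω, α)).2)) = _
    rw [← Measure.map_prod_map _ _ (hgω ω) (hgω ω), hω₁, hω₂]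
  have hJ₁ : J.map P₁ = μ₁ := by
    change (m ⊗ₘ (κ₁ ×ₖ κ₂)).map (Prod.map id Prod.fst) = _
    rw [← Measure.compProd_map measurable_fst, ← Kernel.fst_eq, Kernel.fst_prod, ← hm₁]
    exact μ₁.disintegrate _
  have hJ₂ : J.map P₂ = μ₂ := by
    change (m ⊗ₘ (κ₁ ×ₖ κ₂)).map (Prod.map id Prod.snd) = _
    rw [← Measure.compProd_map measurable_snd, ← Kernel.snd_eq, Kernel.snd_prod, ← hm₂]
    exact μ₂.disintegrate _
  have hc₁ : Function.Semiconj P₁ S (gMap T A) := fun _ => rfl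
  have hc₂ : Function.Semiconj P₂ S (gMap T A) := fun _ => rfl
  let d : Ω × ℝ × ℝ → ℝ := fun q => |Real.sin (Real.pi * (q.2.2 - q.2.1))|
  have hd : Measurable d := by fun_prop
  have hdS : ∀ q, Omega A (P₁ q) * Omega A (P₂ q) * d (S q) = d q := fun q =>
    sin_gMap (T := T) hA.det q.1 q.2.1 q.2.2
  let D : Set (Ω × ℝ × ℝ) := {q | d q ≠ 0}
  have hD : MeasurableSet D := (measurableSet_singleton (0 : ℝ)).compl.preimage hd
  have hO₁ : ∀ q, Omega A (P₁ q) ≠ 0 := fun q => (Omega_pos hA.det _).ne'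
  have hO₂ : ∀ q, Omega A (P₂ q) ≠ 0 := fun q => (Omega_pos hA.det _).ne'
  have hSD : S ⁻¹' D = D := by
    ext q
    simp only [D, mem_preimage, mem_ofPred_eq, ← hdS q, ne_eq, mul_eq_zero, hO₁, hO₂, false_or]
  have hSDc : S ⁻¹' Dᶜ = Dᶜ := by rw [preimage_compl, hSD]
  have hρ : MeasurePreserving S (J.restrict D) (J.restrict D) := by
    simpa only [hSD] using hS.restrict_preimage hD
  have hρ' : MeasurePreserving S (J.restrict Dᶜ) (J.restrict Dᶜ) := by
    simpa only [hSDc] using hS.restrict_preimage hD.compl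
  by_cases hJD : J D = 0
  · left
    have hIco : ∀ {μ : Measure (Ω × ℝ)}, MeasurePreserving (gMap T A) μ μ →
        ∀ᵐ p ∂μ, p.2 ∈ Ico (0 : ℝ) 1 := fun {μ} hμ => by
      rw [← hμ.map_eq, ae_map_iff hg.aemeasurable (measurableSet_Ico.preimage measurable_snd)]
      exact .of_forall fun p => projAngle_mem _
    have e₁ : ∀ᵐ q ∂J, q.2.1 ∈ Ico (0 : ℝ) 1 :=
      ae_of_ae_map hP₁.aemeasurable (hJ₁ ▸ hIco h₁)
    have e₂ : ∀ᵐ q ∂J, q.2.2 ∈ Ico (0 : ℝ) 1 :=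
      ae_of_ae_map hP₂.aemeasurable (hJ₂ ▸ hIco h₂)
    have e₃ : ∀ᵐ q ∂J, q ∉ D := measure_eq_zero_iff_ae_notMem.1 hJD
    rw [← hJ₁, ← hJ₂]
    refine Measure.map_congr ?_
    filter_upwards [e₁, e₂, e₃] with q q₁ q₂ q₃
    have hq : d q = 0 := not_not.1 q₃
    simp only [P₁, P₂, eq_of_sin_eq_zero q₁ q₂ (abs_eq_zero.1 hq)]
  · right
    refine ⟨(J.restrict D).map P₁, (J.restrict Dᶜ).map P₁, (J.restrict D).map P₂,
      (J.restrict Dᶜ).map P₂, ?_, ?_, hρ.map_of_semiconj hP₁ hg hc₁,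
      hρ'.map_of_semiconj hP₁ hg hc₁, hρ.map_of_semiconj hP₂ hg hc₂,
      hρ'.map_of_semiconj hP₂ hg hc₂, ?_, ?_, ?_⟩
    · rw [← Measure.map_add _ _ hP₁, Measure.restrict_add_restrict_compl hD, hJ₁]
    · rw [← Measure.map_add _ _ hP₂, Measure.restrict_add_restrict_compl hD, hJ₂]
    · rw [Measure.map_map measurable_fst hP₁, Measure.map_map measurable_fst hP₂]
      rfl
    · rw [Ne, Measure.map_eq_zero_iff hP₁.aemeasurable, Measure.restrict_eq_zero]
      exact hJD
    · have hlog : Measurable fun p => Real.log (Omega A p) :=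
        Real.measurable_log.comp hA.measurable_Omega
      have hi₁ : Integrable (fun q => Real.log (Omega A (P₁ q))) (J.restrict D) :=
        (hA.integrable_log_Omega ((J.restrict D).map P₁)).comp_measurable hP₁
      have hi₂ : Integrable (fun q => Real.log (Omega A (P₂ q))) (J.restrict D) :=
        (hA.integrable_log_Omega ((J.restrict D).map P₂)).comp_measurable hP₂
      rw [integral_map hP₁.aemeasurable hlog.aestronglyMeasurable,
        integral_map hP₂.aemeasurable hlog.aestronglyMeasurable, ← integral_add hi₁ hi₂]
      have hcob : ∀ᵐ q ∂(J.restrict D), Real.log (Omega A (P₁ q)) + Real.log (Omega A (P₂ q)) =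
          -(Real.log (d (S q)) - Real.log (d q)) := by
        filter_upwards [ae_restrict_mem hD] with q hq
        have hq' : d (S q) ≠ 0 := by rwa [← hSD] at hq
        rw [← hdS q, Real.log_mul (mul_ne_zero (hO₁ q) (hO₂ q)) hq',
          Real.log_mul (hO₁ q) (hO₂ q)]
        ring
      have hcob' : (fun q => Real.log (d (S q)) - Real.log (d q)) =ᵐ[J.restrict D]
          fun q => -(Real.log (Omega A (P₁ q)) + Real.log (Omega A (P₂ q))) := by
        filter_upwards [hcob] with q hq
        rw [hq, neg_neg]
      rw [integral_congr_ae hcob, integral_neg, neg_eq_zero]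
      exact integral_coboundary_eq_zero hρ (Real.measurable_log.comp hd)
        ((hi₁.add hi₂).neg.congr hcob'.symm)

end Joining

/-! ### Extremal lifts -/

section Extremal

variable {Ω : Type*} [MeasurableSpace Ω] {m : Measure Ω} [IsProbabilityMeasure m] {T : Ω ≃ᵐ Ω}
  {A : Ω → Matrix (Fin 2) (Fin 2) ℝ}

lemma Ergodic.exists_eq_nnreal_smul {X : Type*} [MeasurableSpace X] {μ ν : Measure X}
    [IsProbabilityMeasure μ] [IsFiniteMeasure ν] {S : X → X} (hμ : Ergodic S μ)
    (hν : MeasurePreserving S ν ν) (h : ν ≪ μ) : ∃ c : NNReal, ν = c • μ := by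
  obtain ⟨c, hc⟩ := hμ.eq_smul_of_absolutelyContinuous hν h
  have hc' : ν univ = c := by rw [hc]; simp
  refine ⟨c.toNNReal, ?_⟩
  rw [ENNReal.smul_def, ENNReal.coe_toNNReal (hc' ▸ measure_ne_top ν univ)]
  exact hc

lemma exists_map_fst_eq_smul (hm : Ergodic T m) {g : Ω × ℝ → Ω × ℝ} (hg : ∀ p, (g p).1 = T p.1)
    {ν μ : Measure (Ω × ℝ)} [IsFiniteMeasure ν] (hν : MeasurePreserving g ν ν) (hle : ν ≪ μ)
    (hμ : μ.map Prod.fst = m) : ∃ c : NNReal, ν.map Prod.fst = c • m := by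
  have h : MeasurePreserving T (ν.map Prod.fst) (ν.map Prod.fst) :=
    hν.map_of_semiconj measurable_fst T.measurable hg
  exact hm.exists_eq_nnreal_smul h (hμ ▸ hle.map measurable_fst)

variable (hA : BoundedSL A) (hm : Ergodic T m) {lam : ℝ}
  (hlam : Tendsto (fun n : ℕ => (∫ ω, Real.log (opNorm (coc T A n ω)) ∂m) / n) atTop (𝓝 lam))

include hA hm hlam

/-- An invariant part of an extremal lift is extremal. -/
lemma BoundedSL.exists_integral_part_eq {s : ℝ} (hs : |s| = 1) {μ ν ν' : Measure (Ω × ℝ)}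
    [IsProbabilityMeasure μ] (hμ : μ.map Prod.fst = m) (hadd : μ = ν + ν')
    (hν : MeasurePreserving (gMap T A) ν ν) (hν' : MeasurePreserving (gMap T A) ν' ν')
    (hμint : ∫ p, Real.log (Omega A p) ∂μ = s * lam) :
    ∃ c : NNReal, ν.map Prod.fst = c • m ∧ ∫ p, Real.log (Omega A p) ∂ν = s * (c * lam) := by
  have : IsFiniteMeasure ν := isFiniteMeasure_of_le μ (hadd ▸ Measure.le_add_right le_rfl)
  have : IsFiniteMeasure ν' := isFiniteMeasure_of_le μ (hadd ▸ Measure.le_add_left le_rfl)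
  obtain ⟨c, hc⟩ := exists_map_fst_eq_smul hm (fun _ => rfl) hν
    (Measure.absolutelyContinuous_of_le (hadd ▸ Measure.le_add_right le_rfl)) hμ
  obtain ⟨c', hc'⟩ := exists_map_fst_eq_smul hm (fun _ => rfl) hν'
    (Measure.absolutelyContinuous_of_le (hadd ▸ Measure.le_add_left le_rfl)) hμ
  refine ⟨c, hc, ?_⟩
  have hcc : c + c' = 1 := by
    have h1 : (c + c') • m = m := by
      rw [add_smul, ← hc, ← hc', ← Measure.map_add _ _ measurable_fst, ← hadd, hμ]
    have h2 := congrArg (fun ρ : Measure Ω => ρ univ) h1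
    simp only [Measure.smul_apply, measure_univ, ENNReal.smul_def, smul_eq_mul, mul_one] at h2
    exact_mod_cast h2
  have hcc' : (c : ℝ) + c' = 1 := by exact_mod_cast hcc
  have b := abs_le.1 (hA.abs_integral_log_Omega_le T.measurable hlam hν hc)
  have b' := abs_le.1 (hA.abs_integral_log_Omega_le T.measurable hlam hν' hc')
  rw [hadd, integral_add_measure (hA.integrable_log_Omega ν) (hA.integrable_log_Omega ν')] at hμint
  have hl : lam = c * lam + c' * lam := by rw [← add_mul, hcc', one_mul]
  rcases (abs_eq zero_le_one).1 hs with rfl | rfl <;> linarith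

/-- There is at most one lift with given extremal exponent. -/
lemma BoundedSL.eq_of_extremal (hlam0 : 0 < lam) {s : ℝ} (hs : |s| = 1)
    {μ₁ μ₂ : Measure (Ω × ℝ)} [IsProbabilityMeasure μ₁] [IsProbabilityMeasure μ₂]
    (h₁ : MeasurePreserving (gMap T A) μ₁ μ₁) (h₂ : MeasurePreserving (gMap T A) μ₂ μ₂)
    (hm₁ : μ₁.map Prod.fst = m) (hm₂ : μ₂.map Prod.fst = m)
    (hi₁ : ∫ p, Real.log (Omega A p) ∂μ₁ = s * lam)
    (hi₂ : ∫ p, Real.log (Omega A p) ∂μ₂ = s * lam) : μ₁ = μ₂ := by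
  rcases hA.eq_or_exists_opposite hm.toMeasurePreserving h₁ h₂ hm₁ hm₂ with h |
    ⟨ν₁, ν₁', ν₂, ν₂', e₁, e₂, p₁, p₁', p₂, p₂', hfst, hne, hsum⟩
  · exact h
  obtain ⟨c₁, hc₁, k₁⟩ := hA.exists_integral_part_eq hm hlam hs hm₁ e₁ p₁ p₁' hi₁
  obtain ⟨c₂, hc₂, k₂⟩ := hA.exists_integral_part_eq hm hlam hs hm₂ e₂ p₂ p₂' hi₂
  have hs0 : s ≠ 0 := by rintro rfl; simp at hs
  have h0 : ((c₁ : ℝ) + c₂) = 0 := by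
    rw [k₁, k₂, ← mul_add, ← add_mul] at hsum
    exact (mul_eq_zero.1 ((mul_eq_zero.1 hsum).resolve_left hs0)).resolve_right hlam0.ne'
  have hc0 : c₁ = 0 := by
    have := c₁.coe_nonneg
    have := c₂.coe_nonneg
    exact_mod_cast (by linarith : (c₁ : ℝ) = 0)
  refine absurd ?_ hne
  rwa [hc0, zero_smul, Measure.map_eq_zero_iff measurable_fst.aemeasurable] at hc₁

/-- Extremal lifts are ergodic. -/
lemma BoundedSL.ergodic_of_extremal (hlam0 : 0 < lam) {s : ℝ} (hs : |s| = 1)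
    {μ : Measure (Ω × ℝ)} [IsProbabilityMeasure μ] (hμ : MeasurePreserving (gMap T A) μ μ)
    (hmμ : μ.map Prod.fst = m) (hi : ∫ p, Real.log (Omega A p) ∂μ = s * lam) :
    Ergodic (gMap T A) μ := by
  refine ⟨hμ, ⟨fun S hS hSi => ?_⟩⟩
  have hSci : gMap T A ⁻¹' Sᶜ = Sᶜ := by rw [preimage_compl, hSi]
  have hr : MeasurePreserving (gMap T A) (μ.restrict S) (μ.restrict S) := by
    simpa only [hSi] using hμ.restrict_preimage hS
  have hr' : MeasurePreserving (gMap T A) (μ.restrict Sᶜ) (μ.restrict Sᶜ) := by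
    simpa only [hSci] using hμ.restrict_preimage hS.compl
  obtain ⟨c, hc, k⟩ := hA.exists_integral_part_eq hm hlam hs hmμ
    (Measure.restrict_add_restrict_compl hS).symm hr hr' hi
  obtain ⟨c', hc', k'⟩ := hA.exists_integral_part_eq hm hlam hs hmμ
    (by rw [add_comm, Measure.restrict_add_restrict_compl hS]) hr' hr hi
  have hlift : ∀ {ν : Measure (Ω × ℝ)} {c : NNReal}, c ≠ 0 → ν.map Prod.fst = c • m →
      MeasurePreserving (gMap T A) ν ν → ∫ p, Real.log (Omega A p) ∂ν = s * (c * lam) →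
      IsProbabilityMeasure (c⁻¹ • ν) ∧ MeasurePreserving (gMap T A) (c⁻¹ • ν) (c⁻¹ • ν) ∧
        (c⁻¹ • ν).map Prod.fst = m ∧ ∫ p, Real.log (Omega A p) ∂(c⁻¹ • ν) = s * lam := by
    intro ν c h0 hf hp hk
    have hf' : (c⁻¹ • ν).map Prod.fst = m := by
      rw [Measure.map_smul, hf, smul_smul, inv_mul_cancel₀ h0, one_smul]
    refine ⟨?_, ?_, hf', ?_⟩
    · rw [← Measure.isProbabilityMeasure_map_iff measurable_fst.aemeasurable, hf']
      infer_instance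
    · exact hp.smul_measure c⁻¹
    · rw [integral_smul_nnreal_measure, hk, NNReal.smul_def, smul_eq_mul, NNReal.coe_inv]
      have : (c : ℝ) ≠ 0 := by exact_mod_cast h0
      field_simp
  rw [eventuallyConst_set]
  by_cases hc0 : c = 0
  · right
    rw [hc0, zero_smul, Measure.map_eq_zero_iff measurable_fst.aemeasurable,
      Measure.restrict_eq_zero] at hc
    exact measure_eq_zero_iff_ae_notMem.1 hc
  by_cases hc0' : c' = 0
  · left
    rw [hc0', zero_smul, Measure.map_eq_zero_iff measurable_fst.aemeasurable,
      Measure.restrict_eq_zero] at hc'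
    filter_upwards [measure_eq_zero_iff_ae_notMem.1 hc'] with x hx using not_not.1 hx
  obtain ⟨i₁, i₂, i₃, i₄⟩ := hlift hc0 hc hr k
  obtain ⟨j₁, j₂, j₃, j₄⟩ := hlift hc0' hc' hr' k'
  have heq := hA.eq_of_extremal hm hlam hlam0 hs i₂ j₂ i₃ j₃ i₄ j₄
  have h1 := congrArg (fun ρ : Measure (Ω × ℝ) => ρ Sᶜ) heq
  have h2 : (c'⁻¹ • μ.restrict Sᶜ) Sᶜ = 1 := by
    rw [← j₁.measure_univ, Measure.smul_apply, Measure.smul_apply, Measure.restrict_apply_self,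
      Measure.restrict_apply_univ]
  have h3 : (c⁻¹ • μ.restrict S) Sᶜ = 0 := by
    rw [Measure.smul_apply, Measure.restrict_apply hS.compl, compl_inter_self]
    simp
  simp only [h2, h3] at h1
  exact absurd h1 zero_ne_one

/-- Given an extremal lift, any ergodic lift is equal to it or has the opposite exponent. -/
lemma BoundedSL.eq_or_integral_eq_of_extremal {s : ℝ} (hs : |s| = 1)
    {μ₁ μ₂ : Measure (Ω × ℝ)} [IsProbabilityMeasure μ₁] [IsProbabilityMeasure μ₂]
    (h₁ : MeasurePreserving (gMap T A) μ₁ μ₁) (h₂ : Ergodic (gMap T A) μ₂)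
    (hm₁ : μ₁.map Prod.fst = m) (hm₂ : μ₂.map Prod.fst = m)
    (hi₁ : ∫ p, Real.log (Omega A p) ∂μ₁ = s * lam) :
    μ₁ = μ₂ ∨ ∫ p, Real.log (Omega A p) ∂μ₂ = -(s * lam) := by
  rcases hA.eq_or_exists_opposite hm.toMeasurePreserving h₁ h₂.toMeasurePreserving hm₁ hm₂ with h |
    ⟨ν₁, ν₁', ν₂, ν₂', e₁, e₂, p₁, p₁', p₂, p₂', hfst, hne, hsum⟩
  · exact .inl h
  right
  obtain ⟨c₁, hc₁, k₁⟩ := hA.exists_integral_part_eq hm hlam hs hm₁ e₁ p₁ p₁' hi₁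
  have hle : ν₂ ≤ μ₂ := e₂ ▸ Measure.le_add_right le_rfl
  have : IsFiniteMeasure ν₂ := isFiniteMeasure_of_le μ₂ hle
  obtain ⟨c₂, hc₂⟩ := h₂.exists_eq_nnreal_smul p₂ (Measure.absolutelyContinuous_of_le hle)
  have hcc : c₁ = c₂ := by
    have h3 := congrArg (fun ρ : Measure Ω => ρ univ) hfst
    simp only [hc₁, hc₂, Measure.map_smul, hm₂, Measure.smul_apply, measure_univ,
      ENNReal.smul_def, smul_eq_mul, mul_one] at h3
    exact_mod_cast h3
  have hc0 : (c₁ : ℝ) ≠ 0 := by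
    intro h0
    rw [NNReal.coe_eq_zero.1 h0, zero_smul,
      Measure.map_eq_zero_iff measurable_fst.aemeasurable] at hc₁
    exact hne hc₁
  rw [hc₂, integral_smul_nnreal_measure, k₁, ← hcc, NNReal.smul_def, smul_eq_mul] at hsum
  have : (c₁ : ℝ) * (s * lam + ∫ p, Real.log (Omega A p) ∂μ₂) = 0 := by linear_combination hsum
  linarith [(mul_eq_zero.1 this).resolve_left hc0]

end Extremal

/-! ### Limits of empirical averages -/

section KrylovBogoliubov

variable {Y : Type*} [TopologicalSpace Y] [CompactSpace Y] [MeasurableSpace Y] [BorelSpace Y]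

lemma Continuous.integrable_of_compactSpace {f : Y → ℝ} (hf : Continuous f) (ρ : Measure Y)
    [IsFiniteMeasure ρ] : Integrable f ρ :=
  (BoundedContinuousFunction.mkOfCompact ⟨f, hf⟩).integrable ρ

/-- Averages along orbits, over varying initial distributions, accumulate on an invariant measure
whose integrals are the limits of the averaged Birkhoff sums, whenever these limits exist. -/
lemma exists_measurePreserving_integral_eq [HasOuterApproxClosed Y]
    [CompactSpace (ProbabilityMeasure Y)] {G : Y → Y} (hG : Continuous G) (ρ : ℕ → Measure Y)
    [∀ n, IsProbabilityMeasure (ρ n)] :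
    ∃ μ : Measure Y, IsProbabilityMeasure μ ∧ MeasurePreserving G μ μ ∧
      ∀ f : Y → ℝ, Continuous f → ∀ c : ℝ,
        Tendsto (fun n : ℕ => (∫ y, ∑ i ∈ Finset.range n, f (G^[i] y) ∂ρ n) / n) atTop (𝓝 c) →
          ∫ y, f y ∂μ = c := by
  have hGi : ∀ i, Continuous G^[i] := fun i => hG.iterate i
  let ν : ℕ → Measure Y := fun n =>
    (n + 1 : NNReal)⁻¹ • ∑ i ∈ Finset.range (n + 1), (ρ (n + 1)).map G^[i]
  have hν : ∀ n, IsProbabilityMeasure (ν n) := fun n => by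
    constructor
    have h1 : ∀ i, ((ρ (n + 1)).map G^[i]) univ = 1 := fun i => by
      rw [Measure.map_apply (hGi i).measurable MeasurableSet.univ, preimage_univ, measure_univ]
    simp only [ν, Measure.smul_apply, Measure.finsetSum_apply, h1, Finset.sum_const,
      Finset.card_range, nsmul_eq_mul, mul_one, ENNReal.smul_def, smul_eq_mul]
    rw [ENNReal.coe_inv (by positivity)]
    push_cast
    exact ENNReal.inv_mul_cancel (by positivity) (by finiteness)
  have hνi : ∀ f : Y → ℝ, Continuous f → ∀ n, ∫ y, f y ∂ν n =
      (∫ y, ∑ i ∈ Finset.range (n + 1), f (G^[i] y) ∂ρ (n + 1)) / ((n + 1 : ℕ) : ℝ) := by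
    intro f hf n
    have hprob : ∀ i, IsProbabilityMeasure ((ρ (n + 1)).map G^[i]) := fun i =>
      Measure.isProbabilityMeasure_map (hGi i).aemeasurable
    have hfi : ∀ i, Integrable (fun y => f (G^[i] y)) (ρ (n + 1)) := fun i =>
      (hf.comp (hGi i)).integrable_of_compactSpace _
    rw [integral_smul_nnreal_measure,
      integral_finsetSum_measure fun i _ => hf.integrable_of_compactSpace _,
      integral_finsetSum _ fun i _ => hfi i,
      NNReal.smul_def, smul_eq_mul, NNReal.coe_inv, div_eq_inv_mul]
    push_cast
    congr 1
    refine Finset.sum_congr rfl fun i _ => ?_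
    rw [integral_map (hGi i).aemeasurable hf.aestronglyMeasurable]
  let νp : ℕ → ProbabilityMeasure Y := fun n => ⟨ν n, hν n⟩
  let U : Ultrafilter ℕ := .of atTop
  let μ : ProbabilityMeasure Y := (U.map νp).lim
  have hlim : Tendsto νp U (𝓝 μ) := (U.map νp).le_nhds_lim
  have hU : (U : Filter ℕ) ≤ atTop := Ultrafilter.of_le _
  have hlimf : ∀ f : Y → ℝ, Continuous f →
      Tendsto (fun n => ∫ y, f y ∂ν n) U (𝓝 (∫ y, f y ∂(μ : Measure Y))) := fun f hf =>
    (ProbabilityMeasure.tendsto_iff_forall_integral_tendsto.1 hlim)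
      (BoundedContinuousFunction.mkOfCompact ⟨f, hf⟩)
  refine ⟨μ, inferInstance, ⟨hG.measurable, ?_⟩, fun f hf c hc => ?_⟩
  · have : IsProbabilityMeasure ((μ : Measure Y).map G) :=
      Measure.isProbabilityMeasure_map hG.aemeasurable
    refine ext_of_forall_integral_eq_of_IsFiniteMeasure fun f => ?_
    rw [integral_map hG.aemeasurable f.continuous.aestronglyMeasurable]
    have hd := (hlimf _ (f.continuous.comp hG)).sub (hlimf _ f.continuous)
    have hd0 : Tendsto (fun n => ∫ y, (f ∘ G) y ∂ν n - ∫ y, f y ∂ν n) U (𝓝 0) := by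
      refine Tendsto.mono_left ?_ hU
      have hb : Tendsto (fun n : ℕ => (2 * ‖f‖) * (1 / ((n : ℝ) + 1))) atTop (𝓝 0) := by
        simpa using (tendsto_one_div_add_atTop_nhds_zero_nat (𝕜 := ℝ)).const_mul (2 * ‖f‖)
      refine squeeze_zero_norm (fun n => ?_) hb
      have hc : ∀ i, Continuous fun y => f (G^[i] y) := fun i => f.continuous.comp (hGi i)
      have hc' : ∀ i, Continuous fun y => (f ∘ G) (G^[i] y) := fun i =>
        (f.continuous.comp hG).comp (hGi i)
      rw [hνi _ (f.continuous.comp hG), hνi _ f.continuous, ← sub_div, ← integral_sub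
        ((continuous_finsetSum _ fun i _ => hc' i).integrable_of_compactSpace _)
        ((continuous_finsetSum _ fun i _ => hc i).integrable_of_compactSpace _)]
      have htel : ∀ y, ∑ i ∈ Finset.range (n + 1), (f ∘ G) (G^[i] y) -
          ∑ i ∈ Finset.range (n + 1), f (G^[i] y) = f (G^[n + 1] y) - f y := fun y => by
        rw [← Finset.sum_sub_distrib]
        simp only [Function.comp_apply, ← Function.iterate_succ_apply' G]
        exact Finset.sum_range_sub (fun i => f (G^[i] y)) (n + 1)
      simp only [htel]
      rw [norm_div, Real.norm_natCast, ← div_eq_mul_one_div]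
      push_cast
      gcongr
      refine (norm_integral_le_of_norm_le_const (C := 2 * ‖f‖) (.of_forall fun y => ?_)).trans
        (by simp)
      refine (norm_sub_le _ _).trans ?_
      linarith [f.norm_coe_le_norm (G^[n + 1] y), f.norm_coe_le_norm y]
    exact sub_eq_zero.1 (tendsto_nhds_unique hd hd0)
  · refine tendsto_nhds_unique (hlimf f hf) ?_
    refine Tendsto.mono_left ?_ hU
    simp only [hνi f hf]
    exact hc.comp (tendsto_add_atTop_nat 1)

end KrylovBogoliubov

/-! ### Measurable choice of extremal directions -/

section Directions

lemma exists_norm_mulVecE_gt {M : Matrix (Fin 2) (Fin 2) ℝ} {c : ℝ} (hc0 : 0 ≤ c)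
    (hc : c < opNorm M) : ∃ v : R2, ‖v‖ = 1 ∧ c < ‖mulVecE M v‖ := by
  by_contra! hcon
  exact hc.not_ge (ContinuousLinearMap.opNorm_le_of_unit_norm hc0 hcon)

lemma exists_norm_mulVecE_lt {M : Matrix (Fin 2) (Fin 2) ℝ} (hM : M.det = 1) {c : ℝ} (hc0 : 0 < c)
    (hc : c < opNorm M) : ∃ v : R2, ‖v‖ = 1 ∧ ‖mulVecE M v‖ < c⁻¹ := by
  obtain ⟨v, hv, hcv⟩ := exists_norm_mulVecE_gt hc0.le hc
  have hMM : M * M⁻¹ = 1 := Matrix.mul_nonsing_inv _ (by simp [hM])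
  set p : R2 := ‖mulVecE M v‖⁻¹ • perp (mulVecE M v) with hp
  set z : R2 := mulVecE M⁻¹ p with hz
  have hpos : 0 < ‖mulVecE M v‖ := hc0.trans hcv
  have hMz : mulVecE M z = p := by rw [hz, ← mulVecE_mul, hMM, mulVecE_one]
  have hp1 : ‖p‖ = 1 := by
    rw [hp, norm_smul, norm_perp, norm_inv, norm_norm, inv_mul_cancel₀ hpos.ne']
  have hzle : ‖mulVecE M v‖ ≤ ‖z‖ := by
    have h1 := abs_cross_le v z
    have h2 : cross (mulVecE M v) p = ‖mulVecE M v‖ := by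
      have := cross_smul_smul 1 ‖mulVecE M v‖⁻¹ (mulVecE M v) (perp (mulVecE M v))
      rw [one_smul] at this
      rw [hp, this, cross_perp]
      field_simp
    rwa [← cross_mulVecE hM, hMz, h2, hv, one_mul, abs_norm] at h1
  have hz0 : 0 < ‖z‖ := hpos.trans_le hzle
  refine ⟨‖z‖⁻¹ • z, ?_, ?_⟩
  · rw [norm_smul, norm_inv, norm_norm, inv_mul_cancel₀ hz0.ne']
  · rw [mulVecE_smul, hMz, norm_smul, norm_inv, norm_norm, hp1, mul_one]
    exact inv_strictAnti₀ hc0 (hcv.trans_le hzle)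

lemma exists_lt_mul_log_norm_mulVecE {M : Matrix (Fin 2) (Fin 2) ℝ} (hM : M.det = 1) {s : ℝ}
    (hs : |s| = 1) :
    ∃ v : sphere (0 : R2) 1, Real.log (opNorm M) - 1 < s * Real.log ‖mulVecE M v‖ := by
  have hM1 := one_le_opNorm hM
  have hM0 : 0 < opNorm M := one_pos.trans_le hM1
  have hc0 : 0 < opNorm M * Real.exp (-1) := by positivity
  have hc : opNorm M * Real.exp (-1) < opNorm M :=
    mul_lt_of_lt_one_right hM0 (by simp)
  have hlog : Real.log (opNorm M * Real.exp (-1)) = Real.log (opNorm M) - 1 := by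
    rw [Real.log_mul hM0.ne' (Real.exp_pos _).ne', Real.log_exp]; ring
  rcases (abs_eq zero_le_one).1 hs with rfl | rfl
  · obtain ⟨v, hv, h⟩ := exists_norm_mulVecE_gt hc0.le hc
    refine ⟨⟨v, by simpa using hv⟩, ?_⟩
    rw [← hlog, one_mul]
    exact Real.log_lt_log hc0 h
  · obtain ⟨v, hv, h⟩ := exists_norm_mulVecE_lt hM hc0 hc
    refine ⟨⟨v, by simpa using hv⟩, ?_⟩
    have := Real.log_lt_log (norm_mulVecE_pos hM hv) h
    rw [Real.log_inv, hlog] at this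
    linarith

lemma exists_measurable_lt_mul_log_norm_mulVecE {Ω : Type*} [MeasurableSpace Ω]
    {M : Ω → Matrix (Fin 2) (Fin 2) ℝ} (hM : Measurable M) (hdet : ∀ ω, (M ω).det = 1) {s : ℝ}
    (hs : |s| = 1) : ∃ w : Ω → sphere (0 : R2) 1, Measurable w ∧
      ∀ ω, Real.log (opNorm (M ω)) - 1 < s * Real.log ‖mulVecE (M ω) (w ω)‖ := by
  classical
  have : Nonempty (sphere (0 : R2) 1) := (exists_lt_mul_log_norm_mulVecE Matrix.det_one hs).nonempty
  let u : ℕ → sphere (0 : R2) 1 := TopologicalSpace.denseSeq _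
  have hu : DenseRange u := TopologicalSpace.denseRange_denseSeq _
  have hex : ∀ ω, ∃ k, Real.log (opNorm (M ω)) - 1 < s * Real.log ‖mulVecE (M ω) (u k)‖ := by
    intro ω
    have hcont : Continuous fun v : sphere (0 : R2) 1 => s * Real.log ‖mulVecE (M ω) v‖ := by
      refine continuous_const.mul (Continuous.log ?_ fun v =>
        (norm_mulVecE_pos (hdet ω) (by simp)).ne')
      exact (continuous_mulVecE.comp (continuous_const.prodMk continuous_subtype_val)).norm
    obtain ⟨k, hk⟩ := hu.exists_mem_open (isOpen_Ioi.preimage hcont)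
      (exists_lt_mul_log_norm_mulVecE (hdet ω) hs)
    exact ⟨k, hk⟩
  have hmeas : ∀ k, Measurable fun ω => s * Real.log ‖mulVecE (M ω) (u k)‖ := fun k =>
    measurable_const.mul (Real.measurable_log.comp
      (continuous_mulVecE.measurable.comp (hM.prodMk measurable_const)).norm)
  have hmeas' : Measurable fun ω => Real.log (opNorm (M ω)) - 1 :=
    (Real.measurable_log.comp (continuous_opNorm.measurable.comp hM)).sub_const 1
  refine ⟨fun ω => u (Nat.find (hex ω)), ?_, fun ω => Nat.find_spec (hex ω)⟩
  exact measurable_from_nat.comp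
    (measurable_find hex fun k => measurableSet_lt hmeas' (hmeas k))

end Directions

/-! ### Existence of extremal lifts -/

section Existence

open ProbabilityTheory

/-- The two-sided shift. -/
def shiftEquiv (K : Type*) [MeasurableSpace K] : (ℤ → K) ≃ᵐ (ℤ → K) where
  toFun x n := x (n + 1)
  invFun x n := x (n - 1)
  left_inv x := by simp
  right_inv x := by simp
  measurable_toFun := measurable_pi_lambda _ fun n => measurable_pi_apply (n + 1)
  measurable_invFun := measurable_pi_lambda _ fun n => measurable_pi_apply (n - 1)

lemma shiftEquiv_apply {K : Type*} [MeasurableSpace K] (x : ℤ → K) (n : ℤ) :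
    shiftEquiv K x n = x (n + 1) := rfl

/-- The normalised action of the unimodular cocycle on the unit circle. -/
def sphereCocycle {X : Type*} (S : X → X) (B : X → Matrix (Fin 2) (Fin 2) ℝ)
    (hB : ∀ x, (B x).det = 1) (p : X × sphere (0 : R2) 1) : X × sphere (0 : R2) 1 :=
  (S p.1, ⟨‖mulVecE (B p.1) p.2‖⁻¹ • mulVecE (B p.1) p.2, by
    have h : ‖mulVecE (B p.1) p.2‖ ≠ 0 := (norm_mulVecE_pos (hB _) (by simp)).ne'
    rw [mem_sphere_zero_iff_norm, norm_smul, norm_inv, norm_norm, inv_mul_cancel₀ h]⟩)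

section CircleMap

variable {X : Type*} {S : X → X} {B : X → Matrix (Fin 2) (Fin 2) ℝ} (hB : ∀ x, (B x).det = 1)

lemma continuous_sphereCocycle [TopologicalSpace X] (hS : Continuous S) (hBc : Continuous B) :
    Continuous (sphereCocycle S B hB) := by
  have h : Continuous fun p : X × sphere (0 : R2) 1 => mulVecE (B p.1) p.2 :=
    continuous_mulVecE.comp
      ((hBc.comp continuous_fst).prodMk (continuous_subtype_val.comp continuous_snd))
  refine (hS.comp continuous_fst).prodMk (Continuous.subtype_mk ?_ _)
  exact (h.norm.inv₀ fun p => (norm_mulVecE_pos (hB _) (by simp)).ne').smul h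

lemma sum_log_norm_sphereCocycle (n : ℕ) (p : X × sphere (0 : R2) 1) :
    ∑ i ∈ Finset.range n, Real.log ‖mulVecE (B ((sphereCocycle S B hB)^[i] p).1)
      ((sphereCocycle S B hB)^[i] p).2‖ = Real.log ‖mulVecE (coc S B n p.1) p.2‖ := by
  induction n generalizing p with
  | zero => simp [coc, mulVecE_one]
  | succ n ih =>
    have h1 := norm_mulVecE_pos (hB p.1) (v := p.2) (by simp)
    have h2 := norm_mulVecE_pos (det_coc (T := S) hB n (S p.1)) (v := (sphereCocycle S B hB p).2)
      (by simp)
    have h3 : mulVecE (B p.1) p.2 =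
        ‖mulVecE (B p.1) p.2‖ • ((sphereCocycle S B hB p).2 : R2) := by
      simp only [sphereCocycle]
      rw [smul_smul, mul_inv_cancel₀ h1.ne', one_smul]
    rw [Finset.sum_range_succ']
    simp only [Function.iterate_succ_apply, Function.iterate_zero, id_eq]
    have h4 : ‖mulVecE (coc S B (n + 1) p.1) p.2‖ = ‖mulVecE (B p.1) p.2‖ *
        ‖mulVecE (coc S B n (S p.1)) (sphereCocycle S B hB p).2‖ := by
      rw [coc, mulVecE_mul]
      conv_lhs => rw [h3, mulVecE_smul, norm_smul, norm_norm]
    rw [ih, h4, Real.log_mul h1.ne' h2.ne', add_comm]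
    rfl

lemma omega_projAngle (x : X) (v : sphere (0 : R2) 1) :
    Omega B (x, projAngle v) = ‖mulVecE (B x) v‖ := by
  obtain ⟨r, hr, hr'⟩ := exists_smul_vHalf_projAngle v
  conv_rhs => rw [hr', mulVecE_smul, norm_smul, Real.norm_eq_abs, hr]
  simp [Omega]

lemma semiconj_sphereCocycle_gMap : Function.Semiconj
    (fun p : X × sphere (0 : R2) 1 => (p.1, projAngle p.2)) (sphereCocycle S B hB) (gMap S B) := by
  rintro ⟨x, v⟩
  obtain ⟨r, hr, hr'⟩ := exists_smul_vHalf_projAngle v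
  have hr0 : r ≠ 0 := by
    rintro rfl
    simp at hr
  have h1 := norm_mulVecE_pos (hB x) (v := v) (by simp)
  have h2 := norm_mulVecE_pos (hB x) (norm_vHalf (projAngle v))
  refine Prod.ext rfl ?_
  simp only [sphereCocycle, gMap]
  rw [projAngle_smul (inv_ne_zero h1.ne') (norm_pos_iff.1 h1)]
  conv_lhs => rw [hr', mulVecE_smul, projAngle_smul hr0 (norm_pos_iff.1 h2)]

end CircleMap

/-- A lift over a factor can be pulled back along the factor map. -/
lemma exists_lift_of_factor {Ω X : Type*} [MeasurableSpace Ω] [MeasurableSpace X] {m : Measure Ω}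
    [IsProbabilityMeasure m] {T : Ω → Ω} (hT : MeasurePreserving T m m) {S : X ≃ᵐ X} {π : Ω → X}
    (hπ : Measurable π) (hπT : Function.Semiconj π T S) {B : X → Matrix (Fin 2) (Fin 2) ℝ}
    (hB : BoundedSL B) (hA : BoundedSL (B ∘ π)) {μ : Measure (X × ℝ)} [IsProbabilityMeasure μ]
    (hμ : MeasurePreserving (gMap S B) μ μ) (hμm : μ.map Prod.fst = m.map π) :
    ∃ ν : Measure (Ω × ℝ), IsProbabilityMeasure ν ∧ MeasurePreserving (gMap T (B ∘ π)) ν ν ∧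
      ν.map Prod.fst = m ∧
      ∫ p, Real.log (Omega (B ∘ π) p) ∂ν = ∫ p, Real.log (Omega B p) ∂μ := by
  have hS : MeasurePreserving S (m.map π) (m.map π) :=
    hT.map_of_semiconj hπ S.measurable hπT
  have hκ := condKernel_equivariant hS (S := gMap S B) (fun _ => rfl) hμ hμm
  let κ : Kernel Ω ℝ := μ.condKernel.comap π hπ
  have hP : Measurable (Prod.map π id : Ω × ℝ → X × ℝ) := hπ.prodMap measurable_id
  have hmap : (m ⊗ₘ κ).map (Prod.map π id) = μ := by
    conv_rhs => rw [← μ.disintegrate μ.condKernel]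
    refine Measure.ext_of_lintegral _ fun f hf => ?_
    have hfP : Measurable fun p => f (Prod.map π id p) := hf.comp hP
    rw [lintegral_map hf hP, Measure.lintegral_compProd hfP, Measure.lintegral_compProd hf,
      Measure.fst, hμm, lintegral_map hf.lintegral_kernel_prod_right' hπ]
    rfl
  refine ⟨m ⊗ₘ κ, inferInstance, ?_, Measure.fst_compProd m κ, ?_⟩
  · refine measurePreserving_compProd_of_equivariant hT (hA.measurable_gMap hT.measurable)
      (fun _ => rfl) ?_
    filter_upwards [ae_of_ae_map hπ.aemeasurable hκ] with ω hω
    rw [Kernel.comap_apply, Kernel.comap_apply, hπT ω]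
    exact hω
  · have hlog : Measurable fun p => Real.log (Omega B p) :=
      Real.measurable_log.comp hB.measurable_Omega
    conv_rhs => rw [← hmap, integral_map hP.aemeasurable hlog.aestronglyMeasurable]
    rfl

lemma coc_semiconj {Ω X : Type*} {T : Ω → Ω} {S : X → X} {π : Ω → X}
    (hπ : Function.Semiconj π T S) (B : X → Matrix (Fin 2) (Fin 2) ℝ) (n : ℕ) (ω : Ω) :
    coc S B n (π ω) = coc T (B ∘ π) n ω := by
  induction n generalizing ω with
  | zero => rfl
  | succ n ih => rw [coc, coc, ← ih, hπ ω]; rfl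

/-- Over a continuous factor on a compact space there are lifts with extremal exponent. -/
lemma exists_extremal_of_continuous_factor {Ω X : Type*} [MeasurableSpace Ω] {m : Measure Ω}
    [IsProbabilityMeasure m] {T : Ω → Ω} (hT : MeasurePreserving T m m) [TopologicalSpace X]
    [CompactSpace X] [TopologicalSpace.MetrizableSpace X] [SecondCountableTopology X]
    [MeasurableSpace X] [BorelSpace X] {S : X ≃ᵐ X} (hS : Continuous S) {π : Ω → X}
    (hπ : Measurable π) (hπT : Function.Semiconj π T S) {B : X → Matrix (Fin 2) (Fin 2) ℝ}
    (hBc : Continuous B) (hB : BoundedSL B) (hA : BoundedSL (B ∘ π)) {lam : ℝ}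
    (hlam : Tendsto (fun n : ℕ => (∫ ω, Real.log (opNorm (coc T (B ∘ π) n ω)) ∂m) / n)
      atTop (𝓝 lam)) {s : ℝ} (hs : |s| = 1) :
    ∃ ν : Measure (Ω × ℝ), IsProbabilityMeasure ν ∧ MeasurePreserving (gMap T (B ∘ π)) ν ν ∧
      ν.map Prod.fst = m ∧ ∫ p, Real.log (Omega (B ∘ π) p) ∂ν = s * lam := by
  have hss : s * s = 1 := by rw [← abs_mul_abs_self, hs, one_mul]
  choose w hw hw' using fun n => exists_measurable_lt_mul_log_norm_mulVecE
    (hA.measurable_coc hT.measurable n) (det_coc (T := T) hA.det n) hs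
  have hPn : ∀ n, Measurable fun ω => (π ω, w n ω) := fun n => hπ.prodMk (hw n)
  have hprob : ∀ n, IsProbabilityMeasure (m.map fun ω => (π ω, w n ω)) := fun n =>
    Measure.isProbabilityMeasure_map (hPn n).aemeasurable
  have hG := continuous_sphereCocycle hB.det hS hBc
  obtain ⟨μ, hμp, hμG, hμf⟩ := exists_measurePreserving_integral_eq hG
    fun n => m.map fun ω => (π ω, w n ω)
  have hfst : μ.map Prod.fst = m.map π := by
    have : IsProbabilityMeasure (μ.map (Prod.fst : X × sphere (0 : R2) 1 → X)) :=
      Measure.isProbabilityMeasure_map measurable_fst.aemeasurable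
    have : IsProbabilityMeasure (m.map π) := Measure.isProbabilityMeasure_map hπ.aemeasurable
    refine ext_of_forall_integral_eq_of_IsFiniteMeasure fun f => ?_
    rw [integral_map measurable_fst.aemeasurable f.continuous.aestronglyMeasurable]
    refine hμf _ (f.continuous.comp continuous_fst) _ ?_
    refine tendsto_const_nhds.congr' ?_
    filter_upwards [eventually_gt_atTop 0] with n hn
    have hn' : (n : ℝ) ≠ 0 := by exact_mod_cast hn.ne'
    have hit : ∀ i (p : X × sphere (0 : R2) 1), ((sphereCocycle S B hB.det)^[i] p).1 = S^[i] p.1 :=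
      fun i p => (Function.Semiconj.iterate_right (f := Prod.fst)
        (ga := sphereCocycle S B hB.det) (gb := S) (fun _ => rfl) i) p
    simp only [Function.comp_apply, hit]
    have hSm : MeasurePreserving S (m.map π) (m.map π) :=
      hT.map_of_semiconj hπ S.measurable hπT
    have hfi : ∀ i, Integrable (fun x => f (S^[i] x)) (m.map π) := fun i =>
      (f.continuous.comp (hS.iterate i)).integrable_of_compactSpace _
    have hcm : Measurable fun p : X × sphere (0 : R2) 1 =>
        ∑ i ∈ Finset.range n, f (S^[i] p.1) :=
      (continuous_finsetSum _ fun i _ =>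
        (f.continuous.comp (hS.iterate i)).comp continuous_fst).measurable
    have hcm' : Measurable fun x => ∑ i ∈ Finset.range n, f (S^[i] x) :=
      (continuous_finsetSum _ fun i _ => f.continuous.comp (hS.iterate i)).measurable
    rw [integral_map (hPn n).aemeasurable hcm.aestronglyMeasurable,
      ← integral_map hπ.aemeasurable hcm'.aestronglyMeasurable,
      integral_finsetSum _ fun i _ => hfi i]
    have hfS : ∀ i, ∫ x, f (S^[i] x) ∂(m.map π) = ∫ x, f x ∂(m.map π) := fun i =>
      (hSm.iterate i).integral_comp_of_measurable f.continuous.measurable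
    simp only [hfS, Finset.sum_const, Finset.card_range, nsmul_eq_mul]
    field_simp
  have hφ : Continuous fun p : X × sphere (0 : R2) 1 => Real.log ‖mulVecE (B p.1) p.2‖ := by
    refine Continuous.log ?_ fun p => (norm_mulVecE_pos (hB.det _) (by simp)).ne'
    exact (continuous_mulVecE.comp ((hBc.comp continuous_fst).prodMk
      (continuous_subtype_val.comp continuous_snd))).norm
  have hμint : ∫ p, Real.log ‖mulVecE (B p.1) p.2‖ ∂μ = s * lam := by
    refine hμf _ hφ _ ?_
    simp only [sum_log_norm_sphereCocycle]
    have hm1 : ∀ n, Measurable fun p : X × sphere (0 : R2) 1 =>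
        Real.log ‖mulVecE (coc S B n p.1) p.2‖ := fun n =>
      Real.measurable_log.comp (continuous_mulVecE.measurable.comp
        (((hB.measurable_coc S.measurable n).comp measurable_fst).prodMk
          (measurable_subtype_coe.comp measurable_snd))).norm
    have hI : ∀ n, ∫ p, Real.log ‖mulVecE (coc S B n p.1) p.2‖ ∂(m.map fun ω => (π ω, w n ω)) =
        ∫ ω, Real.log ‖mulVecE (coc T (B ∘ π) n ω) (w n ω)‖ ∂m := fun n => by
      rw [integral_map (hPn n).aemeasurable (hm1 n).aestronglyMeasurable]
      simp only [coc_semiconj hπT]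
    simp only [hI]
    have hd : Tendsto (fun n : ℕ => (s * ∫ ω, Real.log ‖mulVecE (coc T (B ∘ π) n ω) (w n ω)‖ ∂m) / n
        - (∫ ω, Real.log (opNorm (coc T (B ∘ π) n ω)) ∂m) / n) atTop (𝓝 0) := by
      refine squeeze_zero_norm (fun n => ?_) (tendsto_one_div_atTop_nhds_zero_nat (𝕜 := ℝ))
      have hb : ∀ ω, |Real.log ‖mulVecE (coc T (B ∘ π) n ω) (w n ω)‖| ≤
          Real.log (opNorm (coc T (B ∘ π) n ω)) := fun ω =>
        abs_log_norm_mulVecE_le (det_coc hA.det _ _) (by simp)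
      have hi1 : Integrable (fun ω => Real.log ‖mulVecE (coc T (B ∘ π) n ω) (w n ω)‖) m := by
        refine (hA.integrable_log_opNorm_coc hT.measurable n m).mono' ?_ (.of_forall hb)
        exact (Real.measurable_log.comp (continuous_mulVecE.measurable.comp
          ((hA.measurable_coc hT.measurable n).prodMk
            (measurable_subtype_coe.comp (hw n)))).norm).aestronglyMeasurable
      rw [← sub_div, ← integral_const_mul, ← integral_sub (hi1.const_mul s)
        (hA.integrable_log_opNorm_coc hT.measurable n m), norm_div, Real.norm_natCast]
      gcongr
      refine (norm_integral_le_of_norm_le_const (C := 1) (.of_forall fun ω => ?_)).trans (by simp)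
      have h1 := hw' n ω
      have h2 : s * Real.log ‖mulVecE (coc T (B ∘ π) n ω) (w n ω)‖ ≤
          Real.log (opNorm (coc T (B ∘ π) n ω)) := by
        refine (le_abs_self _).trans ?_
        rw [abs_mul, hs, one_mul]
        exact hb ω
      rw [Real.norm_eq_abs, abs_le]
      constructor <;> linarith
    have hd' := (hd.add hlam).const_mul s
    rw [zero_add] at hd'
    refine hd'.congr fun n => ?_
    rw [sub_add_cancel, mul_div_assoc, ← mul_assoc, hss, one_mul]
  let P : X × sphere (0 : R2) 1 → X × ℝ := fun p => (p.1, projAngle p.2)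
  have hP : Measurable P := measurable_fst.prodMk
    (measurable_projAngle.comp (measurable_subtype_coe.comp measurable_snd))
  have : IsProbabilityMeasure (μ.map P) := Measure.isProbabilityMeasure_map hP.aemeasurable
  obtain ⟨ν, hν, hν1, hν2, hν3⟩ := exists_lift_of_factor hT hπ hπT hB hA
    (hμG.map_of_semiconj hP (hB.measurable_gMap S.measurable) (semiconj_sphereCocycle_gMap hB.det))
    (by rw [Measure.map_map measurable_fst hP, ← hfst]; rfl)
  refine ⟨ν, hν, hν1, hν2, ?_⟩
  have hlog : Measurable fun p => Real.log (Omega B p) :=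
    Real.measurable_log.comp hB.measurable_Omega
  rw [hν3, integral_map hP.aemeasurable hlog.aestronglyMeasurable, ← hμint]
  simp only [P, omega_projAngle]

end Existence

section ExtremalExistence

lemma abs_apply_le_opNorm (M : Matrix (Fin 2) (Fin 2) ℝ) (i j : Fin 2) : |M i j| ≤ opNorm M := by
  have h1 := norm_mulVecE_le M (EuclideanSpace.single j 1)
  have h2 := PiLp.norm_apply_le (mulVecE M (EuclideanSpace.single j 1)) i
  have h3 : mulVecE M (EuclideanSpace.single j 1) i = M i j := by
    rw [mulVecE_apply]
    fin_cases j <;> simp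
  rw [h3, Real.norm_eq_abs] at h2
  simpa using h2.trans h1

lemma isCompact_det_eq_one_opNorm_le (C : ℝ) :
    IsCompact {M : Matrix (Fin 2) (Fin 2) ℝ | M.det = 1 ∧ opNorm M ≤ C} := by
  have hc : IsCompact (univ.pi fun _ : Fin 2 => univ.pi fun _ : Fin 2 => Icc (-C) C) :=
    isCompact_univ_pi fun _ => isCompact_univ_pi fun _ => isCompact_Icc
  refine IsCompact.of_isClosed_subset (X := Matrix (Fin 2) (Fin 2) ℝ) hc ?_ ?_
  · exact (isClosed_eq (Continuous.matrix_det continuous_id) continuous_const).inter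
      (isClosed_le continuous_opNorm continuous_const)
  · exact fun M hM i _ j _ => abs_le.1 ((abs_apply_le_opNorm M i j).trans hM.2)

lemma BoundedSL.exists_extremal {Ω : Type*} [MeasurableSpace Ω] {m : Measure Ω}
    [IsProbabilityMeasure m] {T : Ω ≃ᵐ Ω} {A : Ω → Matrix (Fin 2) (Fin 2) ℝ} (hA : BoundedSL A)
    (hT : MeasurePreserving T m m) {lam : ℝ}
    (hlam : Tendsto (fun n : ℕ => (∫ ω, Real.log (opNorm (coc T A n ω)) ∂m) / n) atTop (𝓝 lam))
    {s : ℝ} (hs : |s| = 1) :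
    ∃ ν : Measure (Ω × ℝ), IsProbabilityMeasure ν ∧ MeasurePreserving (gMap T A) ν ν ∧
      ν.map Prod.fst = m ∧ ∫ p, Real.log (Omega A p) ∂ν = s * lam := by
  obtain ⟨C, hC⟩ := hA.bdd
  let K := {M : Matrix (Fin 2) (Fin 2) ℝ | M.det = 1 ∧ opNorm M ≤ C}
  have : CompactSpace K := isCompact_iff_compactSpace.1 (isCompact_det_eq_one_opNorm_le C)
  have : TopologicalSpace.MetrizableSpace (Matrix (Fin 2) (Fin 2) ℝ) :=
    inferInstanceAs (TopologicalSpace.MetrizableSpace (Fin 2 → Fin 2 → ℝ))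
  let B : (ℤ → K) → Matrix (Fin 2) (Fin 2) ℝ := fun x => x 0
  have hBc : Continuous B := continuous_subtype_val.comp (continuous_apply 0)
  have hB : BoundedSL B := ⟨hBc.measurable, fun x => (x 0).2.1, C, fun x => (x 0).2.2⟩
  let π : Ω → ℤ → K := fun ω n => ⟨A ((T.toEquiv ^ n : Equiv.Perm Ω) ω), hA.det _, hC _⟩
  have hTn : ∀ n : ℤ, Measurable ((T.toEquiv ^ n : Equiv.Perm Ω) : Ω → Ω) := by
    have hpow : ∀ (e : Ω ≃ᵐ Ω) (k : ℕ), Measurable ((e.toEquiv ^ k : Equiv.Perm Ω) : Ω → Ω) := by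
      intro e k
      rw [Equiv.Perm.coe_pow]
      exact e.measurable.iterate k
    rintro (k | k)
    · exact hpow T k
    · rw [zpow_negSucc, ← inv_pow]
      exact hpow T.symm (k + 1)
  have hπ : Measurable π := measurable_pi_lambda _ fun n =>
    (hA.measurable.comp (hTn n)).subtype_mk
  have hπT : Function.Semiconj π T (shiftEquiv K) := fun ω => by
    funext n
    rw [shiftEquiv_apply]
    refine Subtype.ext ?_
    simp only [π]
    rw [zpow_add_one]
    rfl
  have hBπ : B ∘ π = A := by
    funext ω
    simp [B, π]
  have hS : Continuous (shiftEquiv K) := continuous_pi fun n => continuous_apply (n + 1)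
  simpa only [hBπ] using exists_extremal_of_continuous_factor hT hS hπ hπT hBc hB
    (hBπ ▸ hA) (by rwa [hBπ]) hs

end ExtremalExistence

/-- For a g-invariant ergodic probability measure μ on Θ×𝕋 projecting to
m: if `λ_m(A) = 0` then `λ_μ(F_β,0) = log β`; if `λ_m(A) > 0` then
`λ_μ(F_β,0) ∈ {log β + λ_m(A), log β − λ_m(A)}`, and each of these two values is
attained by exactly one such ergodic measure. -/
theorem stmt11 {Θ : Type*} [MeasurableSpace Θ]
    (γ : Θ ≃ Θ) (hγ : Measurable ⇑γ) (hγ' : Measurable ⇑γ.symm)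
    (m : Measure Θ) [IsProbabilityMeasure m] (herg : Ergodic ⇑γ m)
    (A : Θ → Matrix (Fin 2) (Fin 2) ℝ) (hdet : ∀ θ, (A θ).det = 1)
    (hAmeas : ∀ i j, Measurable fun θ => A θ i j)
    (hAbdd : ∃ C : ℝ, ∀ θ, opNorm (A θ) ≤ C)
    (h : ℝ → ℝ) (hh : GoodH h)
    (lam : ℝ)
    (hlam : Filter.Tendsto
      (fun n : ℕ => (∫ θ, Real.log (opNorm (coc ⇑γ A n θ)) ∂m) / n)
      Filter.atTop (𝓝 lam))
    (β : ℝ) (hβ : 0 < β) :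
    (lam = 0 →
      ∀ μ : Measure (Θ × ℝ), IsProbabilityMeasure μ → Ergodic (gMap ⇑γ A) μ →
        μ.map Prod.fst = m →
        Real.log β + ∫ p, Real.log (Omega A p) ∂μ = Real.log β) ∧
    (0 < lam →
      (∀ μ : Measure (Θ × ℝ), IsProbabilityMeasure μ → Ergodic (gMap ⇑γ A) μ →
        μ.map Prod.fst = m →
        (Real.log β + ∫ p, Real.log (Omega A p) ∂μ = Real.log β + lam ∨
          Real.log β + ∫ p, Real.log (Omega A p) ∂μ = Real.log β - lam)) ∧
      (∃! μ : Measure (Θ × ℝ),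
        (IsProbabilityMeasure μ ∧ Ergodic (gMap ⇑γ A) μ ∧ μ.map Prod.fst = m) ∧
          Real.log β + ∫ p, Real.log (Omega A p) ∂μ = Real.log β + lam) ∧
      (∃! μ : Measure (Θ × ℝ),
        (IsProbabilityMeasure μ ∧ Ergodic (gMap ⇑γ A) μ ∧ μ.map Prod.fst = m) ∧
          Real.log β + ∫ p, Real.log (Omega A p) ∂μ = Real.log β - lam)) := by
  let T : Θ ≃ᵐ Θ := ⟨γ, hγ, hγ'⟩
  have hA : BoundedSL A :=
    ⟨measurable_pi_lambda _ fun i => measurable_pi_lambda _ fun j => hAmeas i j, hdet, hAbdd⟩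
  have hT : Ergodic T m := herg
  refine ⟨fun h0 μ _ hμ hμm => ?_, fun hpos => ?_⟩
  · have hle := hA.abs_integral_log_Omega_le hγ hlam hμ.toMeasurePreserving (c := 1)
      (by rw [one_smul, hμm])
    rw [h0, mul_zero] at hle
    rw [abs_nonpos_iff.1 hle, add_zero]
  have hone : |(1 : ℝ)| = 1 := abs_one
  have hneg : |(-1 : ℝ)| = 1 := by rw [abs_neg, abs_one]
  have hunique : ∀ s : ℝ, |s| = 1 → ∃! μ : Measure (Θ × ℝ),
      (IsProbabilityMeasure μ ∧ Ergodic (gMap ⇑γ A) μ ∧ μ.map Prod.fst = m) ∧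
        Real.log β + ∫ p, Real.log (Omega A p) ∂μ = Real.log β + s * lam := by
    intro s hs
    obtain ⟨μ, hμ, hμi, hμm, hμl⟩ := hA.exists_extremal hT.toMeasurePreserving hlam hs
    refine ⟨μ, ⟨⟨hμ, hA.ergodic_of_extremal hT hlam hpos hs hμi hμm hμl, hμm⟩, by rw [hμl]⟩, ?_⟩
    rintro ν ⟨⟨hν, hνe, hνm⟩, hνl⟩
    exact hA.eq_of_extremal hT hlam hpos hs hνe.toMeasurePreserving hμi hνm hμm
      (add_left_cancel hνl) hμl
  refine ⟨fun μ _ hμ hμm => ?_, ?_, ?_⟩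
  · obtain ⟨ν, hν, hνi, hνm, hνl⟩ := hA.exists_extremal hT.toMeasurePreserving hlam hone
    rw [one_mul] at hνl
    rcases hA.eq_or_integral_eq_of_extremal hT hlam hone hνi hμ hνm hμm (by rw [hνl, one_mul])
      with rfl | hμl
    · exact .inl (by rw [hνl])
    · exact .inr (by rw [hμl, one_mul, sub_eq_add_neg])
  · simpa only [one_mul] using hunique 1 hone
  · simpa only [neg_one_mul, ← sub_eq_add_neg] using hunique (-1) hneg
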